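/- arXiv:1504.04419 — 9 statements merged into one kernel-verified Lean document; each statement's English description precedes it below -/
import Mathlib

section
/- Let X be a random vector in ℝⁿ with a (c₁,c₂)-regular density p and finite second moment E[‖X‖²] < ∞. Then the differential entropy h(X) is finite and satisfies |h(X)| ≤ |log p(0)| + c₂·E[‖X‖] + (c₁/2)·E[‖X‖²]. -/
open MeasureTheory
open scoped ENNReal

noncomputable section

/-- Euclidean space ℝⁿ. -/
abbrev EucSp (n : ℕ) := EuclideanSpace ℝ (Fin n)

/-- A positive, differentiable density `p` on ℝⁿ is `(c₁, c₂)`-regular if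
`‖∇ log p(x)‖ ≤ c₁ ‖x‖ + c₂` for all `x`. -/
def RegularDensity (n : ℕ) (c₁ c₂ : ℝ) (p : EucSp n → ℝ) : Prop :=
  0 < c₁ ∧ 0 ≤ c₂ ∧ (∀ x, 0 < p x) ∧
    Differentiable ℝ (fun x => Real.log (p x)) ∧
    ∀ x, ‖gradient (fun y => Real.log (p y)) x‖ ≤ c₁ * ‖x‖ + c₂

/-- `γ` is a coupling of the probability measures `μ` and `ν` on ℝⁿ. -/
def IsCoupling {n : ℕ} (μ ν : Measure (EucSp n)) (γ : Measure (EucSp n × EucSp n)) : Prop :=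
  IsProbabilityMeasure γ ∧ γ.map Prod.fst = μ ∧ γ.map Prod.snd = ν

/-- The quadratic Wasserstein distance `W₂`. -/
def W2 {n : ℕ} (μ ν : Measure (EucSp n)) : ℝ :=
  sInf { r | ∃ γ, IsCoupling μ ν γ ∧ r = Real.sqrt (∫ z, ‖z.1 - z.2‖ ^ 2 ∂γ) }

/-- The 1-Wasserstein distance `W₁`. -/
def W1 {n : ℕ} (μ ν : Measure (EucSp n)) : ℝ :=
  sInf { r | ∃ γ, IsCoupling μ ν γ ∧ r = ∫ z, ‖z.1 - z.2‖ ∂γ }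

/-- The density of the Gaussian distribution `N(0, σ²Iₙ)` on ℝⁿ. -/
def gaussDensity (σ : ℝ) (n : ℕ) (z : EucSp n) : ℝ :=
  (2 * Real.pi * σ ^ 2) ^ (-(n : ℝ) / 2) * Real.exp (-‖z‖ ^ 2 / (2 * σ ^ 2))

/-- The Gaussian measure `N(0, σ²Iₙ)` on ℝⁿ. -/
def gaussMeasure (σ : ℝ) (n : ℕ) : Measure (EucSp n) :=
  volume.withDensity fun z => ENNReal.ofReal (gaussDensity σ n z)

/-- The distribution of the sum of two independent random vectors with laws `μ` and `ν`. -/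
def convMeasure {n : ℕ} (μ ν : Measure (EucSp n)) : Measure (EucSp n) :=
  (μ.prod ν).map fun p => p.1 + p.2

theorem RegularDensity.norm_sub_le {n : ℕ} {c₁ c₂ : ℝ} {p : EucSp n → ℝ}
    (hreg : RegularDensity n c₁ c₂ p) (x : EucSp n) :
    ‖Real.log (p x) - Real.log (p 0)‖ ≤ c₂ * ‖x‖ + c₁ / 2 * ‖x‖ ^ 2 := by
  obtain ⟨h1, h2, hp, hd, hg⟩ := hreg
  have hder : ∀ t : ℝ, HasDerivAt (fun t : ℝ => Real.log (p (t • x)) - Real.log (p 0))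
      (fderiv ℝ (fun y => Real.log (p y)) (t • x) x) t := by
    intro t
    have hl : HasDerivAt (fun t : ℝ => t • x) x t := by
      simpa using (hasDerivAt_id t).smul_const x
    exact ((hd (t • x)).hasFDerivAt.comp_hasDerivAt t hl).sub_const _
  have hB : ∀ t : ℝ, HasDerivAt (fun t : ℝ => c₂ * ‖x‖ * t + c₁ / 2 * ‖x‖ ^ 2 * t ^ 2)
      (c₂ * ‖x‖ + c₁ * ‖x‖ ^ 2 * t) t := by
    intro t
    refine HasDerivAt.congr_deriv (((hasDerivAt_id t).const_mul (c₂ * ‖x‖)).add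
      ((hasDerivAt_pow 2 t).const_mul (c₁ / 2 * ‖x‖ ^ 2))) ?_
    norm_num
    ring
  have key := image_norm_le_of_norm_deriv_right_le_deriv_boundary (a := (0 : ℝ)) (b := 1)
    (f := fun t : ℝ => Real.log (p (t • x)) - Real.log (p 0))
    (f' := fun t => fderiv ℝ (fun y => Real.log (p y)) (t • x) x)
    (B := fun t : ℝ => c₂ * ‖x‖ * t + c₁ / 2 * ‖x‖ ^ 2 * t ^ 2)
    (B' := fun t => c₂ * ‖x‖ + c₁ * ‖x‖ ^ 2 * t)
    (fun t _ => (hder t).continuousAt.continuousWithinAt)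
    (fun t _ => (hder t).hasDerivWithinAt) (by simp) hB
    (fun t ht => by
      have hn : ‖fderiv ℝ (fun y => Real.log (p y)) (t • x)‖ ≤ c₁ * ‖t • x‖ + c₂ := by
        have := hg (t • x)
        rwa [gradient, LinearIsometryEquiv.norm_map] at this
      rw [norm_smul, Real.norm_of_nonneg ht.1] at hn
      calc _ ≤ _ := ContinuousLinearMap.le_opNorm _ _
        _ ≤ (c₁ * (t * ‖x‖) + c₂) * ‖x‖ := by gcongr
        _ = _ := by ring)
    (x := 1) (by simp)
  simpa using key

/-- If `X` is a random vector in ℝⁿ with a `(c₁,c₂)`-regular density `p` and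
finite second moment, then the differential entropy `h(X) = −E[log p(X)]` is finite (i.e. `log p`
is integrable under the law of `X`) and `|h(X)| ≤ |log p(0)| + c₂ E[‖X‖] + (c₁/2) E[‖X‖²]`. -/
theorem stmt1 {n : ℕ} {c₁ c₂ : ℝ} {p : EucSp n → ℝ} {μ : Measure (EucSp n)}
    [IsProbabilityMeasure μ]
    (hμ : μ = volume.withDensity fun x => ENNReal.ofReal (p x))
    (hreg : RegularDensity n c₁ c₂ p)
    (hmom : Integrable (fun x => ‖x‖ ^ 2) μ) :
    Integrable (fun x => Real.log (p x)) μ ∧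
      |(- ∫ x, Real.log (p x) ∂μ)| ≤
        |Real.log (p 0)| + c₂ * ∫ x, ‖x‖ ∂μ + c₁ / 2 * ∫ x, ‖x‖ ^ 2 ∂μ := by
  have hx : Integrable (fun x : EucSp n => ‖x‖) μ := by
    refine ((integrable_const (1 : ℝ)).add hmom).mono' (by fun_prop) (ae_of_all _ fun x => ?_)
    simp only [norm_norm, Pi.add_apply]
    nlinarith [sq_nonneg (‖x‖ - 1), sq_nonneg (‖x‖)]
  have hbd : ∀ x, ‖Real.log (p x)‖ ≤ |Real.log (p 0)| + c₂ * ‖x‖ + c₁ / 2 * ‖x‖ ^ 2 := by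
    intro x
    have h := hreg.norm_sub_le x
    have h' := norm_sub_norm_le (Real.log (p x)) (Real.log (p 0))
    rw [Real.norm_eq_abs (Real.log (p 0))] at h'
    linarith
  have hi1 : Integrable (fun x : EucSp n => |Real.log (p 0)| + c₂ * ‖x‖) μ :=
    (integrable_const _).add (hx.const_mul c₂)
  have hi2 : Integrable (fun x : EucSp n => c₁ / 2 * ‖x‖ ^ 2) μ := hmom.const_mul _
  refine ⟨(hi1.add hi2).mono' hreg.2.2.2.1.continuous.aestronglyMeasurable
    (ae_of_all _ hbd), ?_⟩
  rw [abs_neg, ← Real.norm_eq_abs]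
  refine (norm_integral_le_of_norm_le (hi1.add hi2) (ae_of_all _ hbd)).trans (le_of_eq ?_)
  simp only [Pi.add_apply]
  rw [integral_add hi1 hi2, integral_add (integrable_const _) (hx.const_mul c₂),
    integral_const_mul, integral_const_mul]
  simp
end
end

section
/- Let U and V be random vectors in ℝⁿ with finite second moments, and suppose V has a (c₁,c₂)-regular density p_V. Then there exists a coupling of P_U and P_V, i.e., a joint distribution of (U,V) with the given marginals, under which E[ | log p_V(V) − log p_V(U) | ] ≤ Δ, where Δ = ( (c₁/2)·√(E[‖U‖²]) + (c₁/2)·√(E[‖V‖²]) + c₂ ) · W₂(P_U, P_V). -/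
open MeasureTheory
open scoped ENNReal

noncomputable section

lemma aux_pointwise {n : ℕ} {c₁ c₂ : ℝ} {p : EucSp n → ℝ} (h : RegularDensity n c₁ c₂ p)
    (u v : EucSp n) :
    |Real.log (p v) - Real.log (p u)| ≤ (c₁ / 2 * ‖u‖ + c₁ / 2 * ‖v‖ + c₂) * ‖u - v‖ := by
  obtain ⟨hc1, hc2, hpos, hd, hg⟩ := h
  set f : EucSp n → ℝ := fun x => Real.log (p x) with hf
  have hfd : ∀ x, ‖fderiv ℝ f x‖ ≤ c₁ * ‖x‖ + c₂ := by
    intro x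
    have := hg x
    rw [← toDual_gradient (𝕜 := ℝ), LinearIsometryEquiv.norm_map]
    exact this
  have hline : ∀ t : ℝ, HasDerivAt (fun t : ℝ => u + t • (v - u)) (v - u) t := by
    intro t
    simpa using ((hasDerivAt_id t).smul_const (v - u)).const_add u
  have hder : ∀ t : ℝ, HasDerivAt (fun t : ℝ => f (u + t • (v - u)) - f u)
      (fderiv ℝ f (u + t • (v - u)) (v - u)) t := by
    intro t
    exact ((hd (u + t • (v - u))).hasFDerivAt.comp_hasDerivAt t (hline t)).sub_const _
  have key := image_norm_le_of_norm_deriv_right_le_deriv_boundary (a := 0) (b := 1)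
    (f := fun t : ℝ => f (u + t • (v - u)) - f u)
    (f' := fun t => fderiv ℝ f (u + t • (v - u)) (v - u))
    (B := fun t => (c₁ * ((t - t ^ 2 / 2) * ‖u‖ + t ^ 2 / 2 * ‖v‖) + c₂ * t) * ‖u - v‖)
    (B' := fun t => (c₁ * ((1 - t) * ‖u‖ + t * ‖v‖) + c₂) * ‖u - v‖)
    (fun t _ => (hder t).continuousAt.continuousWithinAt)
    (fun t _ => (hder t).hasDerivWithinAt) (by simp)
    (by
      intro t
      have h2 : HasDerivAt (fun t : ℝ => t ^ 2 / 2) t t := by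
        have := (hasDerivAt_pow 2 t).div_const 2
        simpa using this
      have h1 := hasDerivAt_id t
      have := ((((((h1.sub h2).mul_const ‖u‖).add (h2.mul_const ‖v‖)).const_mul c₁).add
        (h1.const_mul c₂)).mul_const ‖u - v‖)
      exact this.congr_deriv (by ring))
    (by
      intro t ht
      refine (ContinuousLinearMap.le_opNorm _ _).trans ?_
      rw [norm_sub_rev u v]
      refine mul_le_mul_of_nonneg_right ((hfd _).trans ?_) (norm_nonneg _)
      have : u + t • (v - u) = (1 - t) • u + t • v := by module
      have h3 : ‖u + t • (v - u)‖ ≤ (1 - t) * ‖u‖ + t * ‖v‖ := by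
        rw [this]
        refine (norm_add_le _ _).trans ?_
        rw [norm_smul, norm_smul, Real.norm_of_nonneg (by linarith [ht.2]),
          Real.norm_of_nonneg ht.1]
      gcongr)
    (Set.right_mem_Icc.2 zero_le_one)
  simp only [one_smul, add_sub_cancel, Real.norm_eq_abs] at key
  refine key.trans (le_of_eq ?_)
  ring

lemma aux_cs {α : Type*} [MeasurableSpace α] {μ : Measure α} {f g : α → ℝ}
    (hf0 : ∀ x, 0 ≤ f x) (hg0 : ∀ x, 0 ≤ g x) (hf : MemLp f 2 μ) (hg : MemLp g 2 μ) :
    ∫ a, f a * g a ∂μ ≤ Real.sqrt (∫ a, f a ^ 2 ∂μ) * Real.sqrt (∫ a, g a ^ 2 ∂μ) := by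
  have := integral_mul_le_Lp_mul_Lq_of_nonneg (μ := μ) (f := f) (g := g)
    Real.HolderConjugate.two_two (Filter.Eventually.of_forall hf0)
    (Filter.Eventually.of_forall hg0) (by simpa using hf) (by simpa using hg)
  simpa [Real.sqrt_eq_rpow] using this

lemma aux_coupling {n : ℕ} {c₁ c₂ : ℝ} {pV : EucSp n → ℝ} {μU μV : Measure (EucSp n)}
    (hreg : RegularDensity n c₁ c₂ pV)
    (hU2 : Integrable (fun x => ‖x‖ ^ 2) μU)
    (hV2 : Integrable (fun x => ‖x‖ ^ 2) μV)
    {γ : Measure (EucSp n × EucSp n)} (hγ : IsCoupling μU μV γ) :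
    ∫⁻ z, ENNReal.ofReal |Real.log (pV z.2) - Real.log (pV z.1)| ∂γ ≤
      ENNReal.ofReal ((c₁ / 2 * Real.sqrt (∫ x, ‖x‖ ^ 2 ∂μU) +
        c₁ / 2 * Real.sqrt (∫ x, ‖x‖ ^ 2 ∂μV) + c₂) *
          Real.sqrt (∫ z, ‖z.1 - z.2‖ ^ 2 ∂γ)) := by
  obtain ⟨hp, h1, h2⟩ := hγ
  have hc1 := hreg.1
  have hc2 := hreg.2.1
  have m1 : MemLp (fun z : EucSp n × EucSp n => z.1) 2 γ := by
    have : MemLp (id : EucSp n → EucSp n) 2 μU :=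
      (memLp_two_iff_integrable_sq_norm aestronglyMeasurable_id).2 hU2
    rw [← h1] at this
    exact this.comp_of_map measurable_fst.aemeasurable
  have m2 : MemLp (fun z : EucSp n × EucSp n => z.2) 2 γ := by
    have : MemLp (id : EucSp n → EucSp n) 2 μV :=
      (memLp_two_iff_integrable_sq_norm aestronglyMeasurable_id).2 hV2
    rw [← h2] at this
    exact this.comp_of_map measurable_snd.aemeasurable
  have m3 : MemLp (fun z : EucSp n × EucSp n => z.1 - z.2) 2 γ := m1.sub m2
  have e1 : ∫ z, ‖z.1‖ ^ 2 ∂γ = ∫ x, ‖x‖ ^ 2 ∂μU := by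
    rw [← h1, integral_map measurable_fst.aemeasurable
      (by fun_prop)]
  have e2 : ∫ z, ‖z.2‖ ^ 2 ∂γ = ∫ x, ‖x‖ ^ 2 ∂μV := by
    rw [← h2, integral_map measurable_snd.aemeasurable
      (by fun_prop)]
  have a1 := aux_cs (fun _ => norm_nonneg _) (fun _ => norm_nonneg _) m1.norm m3.norm
  have a2 := aux_cs (fun _ => norm_nonneg _) (fun _ => norm_nonneg _) m2.norm m3.norm
  have a3 := aux_cs (μ := γ) (f := fun _ => 1) (fun _ => zero_le_one) (fun _ => norm_nonneg _)
    (memLp_const _) m3.norm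
  have i1 : Integrable (fun z : EucSp n × EucSp n => ‖z.1‖ * ‖z.1 - z.2‖) γ :=
    m1.norm.integrable_mul m3.norm
  have i2 : Integrable (fun z : EucSp n × EucSp n => ‖z.2‖ * ‖z.1 - z.2‖) γ :=
    m2.norm.integrable_mul m3.norm
  have i3 := m3.norm.integrable (by norm_num)
  rw [e1] at a1
  rw [e2] at a2
  simp only [one_mul, one_pow, integral_const, probReal_univ, smul_eq_mul, mul_one,
    Real.sqrt_one] at a3
  set W := Real.sqrt (∫ z, ‖z.1 - z.2‖ ^ 2 ∂γ)
  have hint : Integrable (fun z : EucSp n × EucSp n =>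
      c₁ / 2 * (‖z.1‖ * ‖z.1 - z.2‖) + c₁ / 2 * (‖z.2‖ * ‖z.1 - z.2‖) + c₂ * ‖z.1 - z.2‖) γ :=
    ((i1.const_mul _).add (i2.const_mul _)).add (i3.const_mul _)
  calc ∫⁻ z, ENNReal.ofReal |Real.log (pV z.2) - Real.log (pV z.1)| ∂γ
      ≤ ∫⁻ z, ENNReal.ofReal (c₁ / 2 * (‖z.1‖ * ‖z.1 - z.2‖) +
          c₁ / 2 * (‖z.2‖ * ‖z.1 - z.2‖) + c₂ * ‖z.1 - z.2‖) ∂γ := by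
        refine lintegral_mono fun z => ENNReal.ofReal_le_ofReal ?_
        refine (aux_pointwise hreg z.1 z.2).trans (le_of_eq ?_)
        ring
    _ = ENNReal.ofReal (∫ z, (c₁ / 2 * (‖z.1‖ * ‖z.1 - z.2‖) +
          c₁ / 2 * (‖z.2‖ * ‖z.1 - z.2‖) + c₂ * ‖z.1 - z.2‖) ∂γ) := by
        rw [ofReal_integral_eq_lintegral_ofReal hint]
        exact Filter.Eventually.of_forall fun z => by positivity
    _ ≤ _ := by
        refine ENNReal.ofReal_le_ofReal ?_
        have s1 : ∫ z, (c₁ / 2 * (‖z.1‖ * ‖z.1 - z.2‖) +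
            c₁ / 2 * (‖z.2‖ * ‖z.1 - z.2‖) + c₂ * ‖z.1 - z.2‖) ∂γ =
            c₁ / 2 * ∫ z, ‖z.1‖ * ‖z.1 - z.2‖ ∂γ + c₁ / 2 * ∫ z, ‖z.2‖ * ‖z.1 - z.2‖ ∂γ +
              c₂ * ∫ z, ‖z.1 - z.2‖ ∂γ := by
          rw [← integral_const_mul, ← integral_const_mul, ← integral_const_mul,
            ← integral_add (i1.const_mul _) (i2.const_mul _), ← integral_add _ (i3.const_mul _)]
          exact (i1.const_mul _).add (i2.const_mul _)
        rw [s1]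
        have b1 := mul_le_mul_of_nonneg_left a1 (by positivity : 0 ≤ c₁ / 2)
        have b2 := mul_le_mul_of_nonneg_left a2 (by positivity : 0 ≤ c₁ / 2)
        have b3 := mul_le_mul_of_nonneg_left a3 hc2
        linarith

/-- If `U, V` have finite second moments and `V` has a `(c₁,c₂)`-regular
density `pV`, then there exists a coupling of `P_U` and `P_V` under which
`E[|log pV(V) − log pV(U)|] ≤ Δ`, with
`Δ = ((c₁/2)√E[‖U‖²] + (c₁/2)√E[‖V‖²] + c₂) · W₂(P_U, P_V)`. -/
theorem stmt2 {n : ℕ} {c₁ c₂ : ℝ} {pV : EucSp n → ℝ} {μU μV : Measure (EucSp n)}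
    [IsProbabilityMeasure μU] [IsProbabilityMeasure μV]
    (hV : μV = volume.withDensity fun x => ENNReal.ofReal (pV x))
    (hreg : RegularDensity n c₁ c₂ pV)
    (hU2 : Integrable (fun x => ‖x‖ ^ 2) μU)
    (hV2 : Integrable (fun x => ‖x‖ ^ 2) μV) :
    ∃ γ, IsCoupling μU μV γ ∧
      ∫ z, |Real.log (pV z.2) - Real.log (pV z.1)| ∂γ ≤
        (c₁ / 2 * Real.sqrt (∫ x, ‖x‖ ^ 2 ∂μU) + c₁ / 2 * Real.sqrt (∫ x, ‖x‖ ^ 2 ∂μV) + c₂) *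
          W2 μU μV := by
  classical
  set K := c₁ / 2 * Real.sqrt (∫ x, ‖x‖ ^ 2 ∂μU) + c₁ / 2 * Real.sqrt (∫ x, ‖x‖ ^ 2 ∂μV) + c₂
    with hK
  have hc1 := hreg.1
  have hc2 := hreg.2.1
  have hK0 : 0 ≤ K := by positivity
  have hW0 : 0 ≤ W2 μU μV := by
    refine Real.sInf_nonneg ?_
    rintro r ⟨γ, _, rfl⟩
    exact Real.sqrt_nonneg _
  have hne : { r | ∃ γ, IsCoupling μU μV γ ∧
      r = Real.sqrt (∫ z, ‖z.1 - z.2‖ ^ 2 ∂γ) }.Nonempty :=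
    ⟨_, μU.prod μV, ⟨inferInstance, by simp [Measure.map_fst_prod],
      by simp [Measure.map_snd_prod]⟩, rfl⟩
  have hseq : ∀ k : ℕ, ∃ γ : ProbabilityMeasure (EucSp n × EucSp n),
      IsCoupling μU μV (γ : Measure (EucSp n × EucSp n)) ∧
      Real.sqrt (∫ z, ‖z.1 - z.2‖ ^ 2 ∂(γ : Measure (EucSp n × EucSp n))) <
        W2 μU μV + 1 / ((k : ℝ) + 1) := by
    intro k
    obtain ⟨r, ⟨γ, hγ, rfl⟩, hr⟩ := exists_lt_of_csInf_lt hne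
      (show W2 μU μV < W2 μU μV + 1 / ((k : ℝ) + 1) from
        lt_add_of_pos_right _ Nat.one_div_pos_of_nat)
    exact ⟨⟨γ, hγ.1⟩, hγ, hr⟩
  choose g hg hgW using hseq
  let S : Set (ProbabilityMeasure (EucSp n × EucSp n)) :=
    {γ | IsCoupling μU μV (γ : Measure (EucSp n × EucSp n))}
  have htight : IsTightMeasureSet
      {((γ : ProbabilityMeasure (EucSp n × EucSp n)) : Measure (EucSp n × EucSp n)) | γ ∈ S} := by
    refine IsTightMeasureSet.prodMk ?_ ?_
    · refine (isTightMeasureSet_singleton (μ := μU)).subset ?_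
      rintro _ ⟨_, ⟨γ, hγ, rfl⟩, rfl⟩
      exact hγ.2.1
    · refine (isTightMeasureSet_singleton (μ := μV)).subset ?_
      rintro _ ⟨_, ⟨γ, hγ, rfl⟩, rfl⟩
      exact hγ.2.2
  have hcomp := isCompact_closure_of_isTightMeasureSet htight
  obtain ⟨γ, _, φ, hφ, hlim⟩ := hcomp.isSeqCompact (x := g) (fun k => subset_closure (hg k))
  have hγ : IsCoupling μU μV (γ : Measure (EucSp n × EucSp n)) := by
    refine ⟨inferInstance, ?_, ?_⟩
    · have := ProbabilityMeasure.tendsto_map_of_tendsto_of_continuous _ _ hlim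
        (continuous_fst (X := EucSp n) (Y := EucSp n))
      have h2 : Filter.Tendsto (fun i => ((g ∘ φ) i).map
          (continuous_fst (X := EucSp n) (Y := EucSp n)).measurable.aemeasurable) Filter.atTop
          (nhds (⟨μU, inferInstance⟩ : ProbabilityMeasure (EucSp n))) := by
        refine tendsto_const_nhds.congr fun i => ?_
        exact Subtype.ext (hg (φ i)).2.1.symm
      have h3 := tendsto_nhds_unique this h2
      exact congrArg (fun m : ProbabilityMeasure (EucSp n) => (m : Measure (EucSp n))) h3
    · have := ProbabilityMeasure.tendsto_map_of_tendsto_of_continuous _ _ hlim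
        (continuous_snd (X := EucSp n) (Y := EucSp n))
      have h2 : Filter.Tendsto (fun i => ((g ∘ φ) i).map
          (continuous_snd (X := EucSp n) (Y := EucSp n)).measurable.aemeasurable) Filter.atTop
          (nhds (⟨μV, inferInstance⟩ : ProbabilityMeasure (EucSp n))) := by
        refine tendsto_const_nhds.congr fun i => ?_
        exact Subtype.ext (hg (φ i)).2.2.symm
      have h3 := tendsto_nhds_unique this h2
      exact congrArg (fun m : ProbabilityMeasure (EucSp n) => (m : Measure (EucSp n))) h3
  refine ⟨γ, hγ, ?_⟩
  have hcont : Continuous fun x => Real.log (pV x) := hreg.2.2.2.1.continuous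
  have hfc : Continuous fun z : EucSp n × EucSp n =>
      |Real.log (pV z.2) - Real.log (pV z.1)| :=
    ((hcont.comp continuous_snd).sub (hcont.comp continuous_fst)).abs
  have hlsc := lintegral_le_liminf_lintegral_of_forall_isOpen_measure_le_liminf_measure
    (μ := (γ : Measure (EucSp n × EucSp n)))
    (μs := fun i => ((g (φ i) : ProbabilityMeasure _) : Measure (EucSp n × EucSp n)))
    hfc (fun _ => abs_nonneg _)
    (fun G hG => ProbabilityMeasure.le_liminf_measure_open_of_tendsto hlim hG)
  have hT : Filter.Tendsto (fun i : ℕ => ENNReal.ofReal (K * (W2 μU μV + 1 / ((φ i : ℝ) + 1))))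
      Filter.atTop (nhds (ENNReal.ofReal (K * W2 μU μV))) := by
    refine ENNReal.tendsto_ofReal ?_
    have h0 := (tendsto_one_div_add_atTop_nhds_zero_nat (𝕜 := ℝ)).comp hφ.tendsto_atTop
    simpa using (h0.const_add (W2 μU μV)).const_mul K
  have hle : ∫⁻ z, ENNReal.ofReal |Real.log (pV z.2) - Real.log (pV z.1)|
      ∂(γ : Measure (EucSp n × EucSp n)) ≤ ENNReal.ofReal (K * W2 μU μV) := by
    refine hlsc.trans ?_
    rw [← hT.liminf_eq]
    refine Filter.liminf_le_liminf (Filter.Eventually.of_forall fun i => ?_)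
    refine (aux_coupling hreg hU2 hV2 (hg (φ i))).trans (ENNReal.ofReal_le_ofReal ?_)
    exact mul_le_mul_of_nonneg_left (hgW (φ i)).le hK0
  rw [integral_eq_lintegral_of_nonneg_ae (Filter.Eventually.of_forall fun _ => abs_nonneg _)
    hfc.aestronglyMeasurable]
  exact ENNReal.toReal_le_of_le_ofReal (mul_nonneg hK0 hW0) hle
end
end

section
/- Let U and V be random vectors in ℝⁿ with finite second moments, both having (c₁,c₂)-regular densities. Then D(P_U‖P_V) + D(P_V‖P_U) ≤ 2Δ, where Δ = ( (c₁/2)·√(E[‖U‖²]) + (c₁/2)·√(E[‖V‖²]) + c₂ ) · W₂(P_U, P_V). -/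
open MeasureTheory
open scoped ENNReal

noncomputable section

lemma log_diff_bound {n : ℕ} {c₁ c₂ : ℝ} {p : EucSp n → ℝ} (h : RegularDensity n c₁ c₂ p)
    (x y : EucSp n) : |Real.log (p y) - Real.log (p x)| ≤
      (c₁ / 2 * ‖x‖ + c₁ / 2 * ‖y‖ + c₂) * ‖x - y‖ := by
  obtain ⟨hc1, hc2, -, hd, hg⟩ := h
  set a : EucSp n → ℝ := fun x => Real.log (p x) with ha
  let ℓ : ℝ → EucSp n := fun t => x + t • (y - x)
  have hℓ : ∀ t, HasDerivAt ℓ (y - x) t := by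
    intro t
    have := ((hasDerivAt_id t).smul_const (y - x)).const_add x
    simpa [ℓ] using this
  have hf : ∀ t, HasDerivAt (fun t => a (ℓ t) - a x) (fderiv ℝ a (ℓ t) (y - x)) t := by
    intro t
    exact (((hd (ℓ t)).hasFDerivAt).comp_hasDerivAt t (hℓ t)).sub_const _
  have hB : ∀ t, HasDerivAt
      (fun t : ℝ => (c₁ * (t * ‖x‖ + t ^ 2 / 2 * (‖y‖ - ‖x‖)) + c₂ * t) * ‖x - y‖)
      ((c₁ * (‖x‖ + t * (‖y‖ - ‖x‖)) + c₂) * ‖x - y‖) t := by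
    intro t
    have h1 : HasDerivAt (fun t : ℝ => t * ‖x‖) (1 * ‖x‖) t := (hasDerivAt_id t).mul_const _
    have h2 : HasDerivAt (fun t : ℝ => t ^ 2 / 2 * (‖y‖ - ‖x‖)) (t * (‖y‖ - ‖x‖)) t := by
      have := ((hasDerivAt_pow 2 t).div_const 2).mul_const (‖y‖ - ‖x‖)
      refine this.congr_deriv ?_
      norm_num
    have h3 : HasDerivAt (fun t : ℝ => c₂ * t) (c₂ * 1) t := (hasDerivAt_id t).const_mul _
    refine ((((h1.add h2).const_mul c₁).add h3).mul_const ‖x - y‖).congr_deriv ?_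
    ring
  have key := image_norm_le_of_norm_deriv_right_le_deriv_boundary (a := 0) (b := 1)
    (f := fun t => a (ℓ t) - a x) (f' := fun t => fderiv ℝ a (ℓ t) (y - x))
    (fun t _ => (hf t).continuousAt.continuousWithinAt)
    (fun t _ => (hf t).hasDerivWithinAt) (B := _) (B' := _) (by simp [ℓ]) hB ?_
    (show (1 : ℝ) ∈ Set.Icc 0 1 by simp)
  · simp only [ℓ, one_smul, add_sub_cancel, Real.norm_eq_abs] at key
    refine key.trans (le_of_eq ?_)
    ring
  · intro t ht
    have h1 := (fderiv ℝ a (ℓ t)).le_opNorm (y - x)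
    have h2 : ‖fderiv ℝ a (ℓ t)‖ = ‖gradient a (ℓ t)‖ := by
      simp [gradient]
    have h3 : ‖ℓ t‖ ≤ ‖x‖ + t * (‖y‖ - ‖x‖) := by
      have : ℓ t = (1 - t) • x + t • y := by simp only [ℓ]; module
      rw [this]
      refine (norm_add_le _ _).trans ?_
      rw [norm_smul, norm_smul, Real.norm_of_nonneg ht.1,
        Real.norm_of_nonneg (by linarith [ht.2])]
      linarith
    rw [norm_sub_rev x y]
    refine h1.trans ?_
    rw [h2]
    have := hg (ℓ t)
    gcongr
    refine this.trans ?_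
    gcongr

lemma cs_aux {α : Type*} [MeasurableSpace α] {μ : Measure α} {f g : α → ℝ}
    (hf0 : ∀ x, 0 ≤ f x) (hg0 : ∀ x, 0 ≤ g x) (hf : MemLp f 2 μ) (hg : MemLp g 2 μ) :
    ∫ x, f x * g x ∂μ ≤ Real.sqrt (∫ x, f x ^ 2 ∂μ) * Real.sqrt (∫ x, g x ^ 2 ∂μ) := by
  have := integral_mul_le_Lp_mul_Lq_of_nonneg (μ := μ) (p := 2) (q := 2) (f := f) (g := g)
    Real.HolderConjugate.two_two (Filter.Eventually.of_forall hf0)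
    (Filter.Eventually.of_forall hg0) (by simpa using hf) (by simpa using hg)
  simpa [Real.sqrt_eq_rpow] using this

lemma log_integrable {n : ℕ} {c₁ c₂ : ℝ} {p : EucSp n → ℝ} (h : RegularDensity n c₁ c₂ p)
    {μ : Measure (EucSp n)} [IsProbabilityMeasure μ] (h2 : Integrable (fun x => ‖x‖ ^ 2) μ) :
    Integrable (fun x => Real.log (p x)) μ := by
  have hc := h.2.2.2.1.continuous
  have h1 : Integrable (fun x : EucSp n => ‖x‖) μ := by
    have : MemLp (fun x : EucSp n => ‖x‖) 2 μ :=
      (memLp_two_iff_integrable_sq continuous_norm.aestronglyMeasurable).2 h2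
    exact this.integrable (by norm_num)
  refine Integrable.mono' (g := fun x => |Real.log (p 0)| + (c₁ / 2 * ‖x‖ ^ 2 + c₂ * ‖x‖))
    ((integrable_const _).add ((h2.const_mul _).add (h1.const_mul _)))
    hc.aestronglyMeasurable (Filter.Eventually.of_forall fun x => ?_)
  have := log_diff_bound h 0 x
  simp only [norm_zero, zero_sub, norm_neg] at this
  have h3 := abs_sub_abs_le_abs_sub (Real.log (p x)) (Real.log (p 0))
  rw [Real.norm_eq_abs]
  nlinarith

/-- If `U, V` have finite second moments and both have `(c₁,c₂)`-regular
densities, then `D(P_U‖P_V) + D(P_V‖P_U) ≤ 2Δ`, where the KL divergences are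
`D(P_U‖P_V) = ∫ log (pU/pV) dP_U` and `D(P_V‖P_U) = ∫ log (pV/pU) dP_V` (both laws have
everywhere-positive densities, so they are mutually absolutely continuous), and
`Δ = ((c₁/2)√E[‖U‖²] + (c₁/2)√E[‖V‖²] + c₂) · W₂(P_U, P_V)`. -/
theorem stmt5 {n : ℕ} {c₁ c₂ : ℝ} {pU pV : EucSp n → ℝ} {μU μV : Measure (EucSp n)}
    [IsProbabilityMeasure μU] [IsProbabilityMeasure μV]
    (hU : μU = volume.withDensity fun x => ENNReal.ofReal (pU x))
    (hV : μV = volume.withDensity fun x => ENNReal.ofReal (pV x))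
    (hregU : RegularDensity n c₁ c₂ pU)
    (hregV : RegularDensity n c₁ c₂ pV)
    (hU2 : Integrable (fun x => ‖x‖ ^ 2) μU)
    (hV2 : Integrable (fun x => ‖x‖ ^ 2) μV) :
    (∫ x, Real.log (pU x / pV x) ∂μU) + (∫ x, Real.log (pV x / pU x) ∂μV) ≤
      2 * ((c₁ / 2 * Real.sqrt (∫ x, ‖x‖ ^ 2 ∂μU) + c₁ / 2 * Real.sqrt (∫ x, ‖x‖ ^ 2 ∂μV) + c₂) *
        W2 μU μV) := by
  have hc1 := hregU.1
  have hc2 := hregU.2.1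
  set K := c₁ / 2 * Real.sqrt (∫ x, ‖x‖ ^ 2 ∂μU) + c₁ / 2 * Real.sqrt (∫ x, ‖x‖ ^ 2 ∂μV) + c₂
    with hK
  have hK0 : 0 ≤ K := by positivity
  set f : EucSp n → ℝ := fun x => Real.log (pU x) - Real.log (pV x) with hf
  have hfc : Continuous f := hregU.2.2.2.1.continuous.sub hregV.2.2.2.1.continuous
  have hfU : Integrable f μU := (log_integrable hregU hU2).sub (log_integrable hregV hU2)
  have hfV : Integrable f μV := (log_integrable hregU hV2).sub (log_integrable hregV hV2)
  have e1 : ∫ x, Real.log (pU x / pV x) ∂μU = ∫ x, f x ∂μU := by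
    congr 1; ext x
    exact Real.log_div (hregU.2.2.1 x).ne' (hregV.2.2.1 x).ne'
  have e2 : ∫ x, Real.log (pV x / pU x) ∂μV = - ∫ x, f x ∂μV := by
    rw [← integral_neg]
    congr 1; ext x
    rw [Real.log_div (hregV.2.2.1 x).ne' (hregU.2.2.1 x).ne']
    simp [f]
  rw [e1, e2]
  have main : ∀ γ, IsCoupling μU μV γ → (∫ x, f x ∂μU) + -(∫ x, f x ∂μV) ≤
      2 * (K * Real.sqrt (∫ z, ‖z.1 - z.2‖ ^ 2 ∂γ)) := by
    rintro γ ⟨hγ, hγ1, hγ2⟩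
    have hm1 : MeasurePreserving (Prod.fst : EucSp n × EucSp n → _) γ μU := ⟨measurable_fst, hγ1⟩
    have hm2 : MeasurePreserving (Prod.snd : EucSp n × EucSp n → _) γ μV := ⟨measurable_snd, hγ2⟩
    have i1 : ∀ g : EucSp n → ℝ, Continuous g → ∫ x, g x ∂μU = ∫ z, g z.1 ∂γ := by
      intro g hg
      rw [← hγ1, integral_map measurable_fst.aemeasurable hg.aestronglyMeasurable]
    have i2 : ∀ g : EucSp n → ℝ, Continuous g → ∫ x, g x ∂μV = ∫ z, g z.2 ∂γ := by
      intro g hg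
      rw [← hγ2, integral_map measurable_snd.aemeasurable hg.aestronglyMeasurable]
    have hf1 : Integrable (fun z : EucSp n × EucSp n => f z.1) γ :=
      hm1.integrable_comp_of_integrable hfU
    have hf2 : Integrable (fun z : EucSp n × EucSp n => f z.2) γ :=
      hm2.integrable_comp_of_integrable hfV
    have L1 : MemLp (fun z : EucSp n × EucSp n => z.1) 2 γ :=
      ((memLp_two_iff_integrable_sq_norm continuous_id.aestronglyMeasurable).2
        hU2).comp_measurePreserving hm1
    have L2 : MemLp (fun z : EucSp n × EucSp n => z.2) 2 γ :=
      ((memLp_two_iff_integrable_sq_norm continuous_id.aestronglyMeasurable).2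
        hV2).comp_measurePreserving hm2
    have L3 : MemLp (fun z : EucSp n × EucSp n => ‖z.1 - z.2‖) 2 γ := (L1.sub L2).norm
    have L4 : MemLp (fun z : EucSp n × EucSp n => (1 : ℝ)) 2 γ := memLp_const _
    have I1 : Integrable (fun z : EucSp n × EucSp n => ‖z.1‖ * ‖z.1 - z.2‖) γ :=
      L1.norm.integrable_mul L3
    have I2 : Integrable (fun z : EucSp n × EucSp n => ‖z.2‖ * ‖z.1 - z.2‖) γ :=
      L2.norm.integrable_mul L3
    have I3 : Integrable (fun z : EucSp n × EucSp n => (1 : ℝ) * ‖z.1 - z.2‖) γ :=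
      L4.integrable_mul L3
    have C1 := cs_aux (fun _ => norm_nonneg _) (fun _ => norm_nonneg _) L1.norm L3
    have C2 := cs_aux (fun _ => norm_nonneg _) (fun _ => norm_nonneg _) L2.norm L3
    have C3 := cs_aux (fun _ => zero_le_one) (fun _ => norm_nonneg _) L4 L3
    rw [← i1 (fun x => ‖x‖ ^ 2) (by fun_prop)] at C1
    rw [← i2 (fun x => ‖x‖ ^ 2) (by fun_prop)] at C2
    simp only [one_pow, integral_const, probReal_univ, smul_eq_mul, mul_one, Real.sqrt_one] at C3
    rw [i1 f hfc, i2 f hfc, ← sub_eq_add_neg, ← integral_sub hf1 hf2]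
    have step : ∫ z, (f z.1 - f z.2) ∂γ ≤ ∫ z, (c₁ * (‖z.1‖ * ‖z.1 - z.2‖)
        + c₁ * (‖z.2‖ * ‖z.1 - z.2‖) + 2 * c₂ * (1 * ‖z.1 - z.2‖)) ∂γ := by
      refine integral_mono (hf1.sub hf2)
        (((I1.const_mul _).add (I2.const_mul _)).add (I3.const_mul _)) fun z => ?_
      have b1 := (abs_le.1 (log_diff_bound hregU z.1 z.2)).1
      have b2 := (abs_le.1 (log_diff_bound hregV z.1 z.2)).2
      simp only [f]
      linarith
    refine step.trans ?_
    have I12 : Integrable (fun z : EucSp n × EucSp n => c₁ * (‖z.1‖ * ‖z.1 - z.2‖)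
        + c₁ * (‖z.2‖ * ‖z.1 - z.2‖)) γ := (I1.const_mul _).add (I2.const_mul _)
    rw [integral_add I12 (I3.const_mul _),
      integral_add (I1.const_mul _) (I2.const_mul _), integral_const_mul, integral_const_mul,
      integral_const_mul]
    have D1 := mul_le_mul_of_nonneg_left C1 hc1.le
    have D2 := mul_le_mul_of_nonneg_left C2 hc1.le
    have D3 := mul_le_mul_of_nonneg_left C3 (by positivity : 0 ≤ 2 * c₂)
    rw [hK]
    simp only [one_mul] at D3 ⊢
    linarith
  have hprod : IsCoupling μU μV (μU.prod μV) :=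
    ⟨inferInstance, by simp [Measure.map_fst_prod], by simp [Measure.map_snd_prod]⟩
  rcases hK0.eq_or_lt with h0 | h0
  · have := main _ hprod
    rw [← h0] at this ⊢
    simpa using this
  · have : ((∫ x, f x ∂μU) + -(∫ x, f x ∂μV)) / (2 * K) ≤ W2 μU μV := by
      refine le_csInf ⟨_, _, hprod, rfl⟩ ?_
      rintro r ⟨γ, hγ, rfl⟩
      rw [div_le_iff₀ (by positivity)]
      linarith [main γ hγ]
    rw [div_le_iff₀ (by positivity)] at this
    linarith
end
end

section
/- Let V = B + Z where B and Z are independent random vectors in ℝⁿ, Z ∼ N(0, σ²Iₙ) is Gaussian, and E[‖B‖] < ∞. Then the density of V is (c₁,c₂)-regular with c₁ = 3/σ² and c₂ = (4/σ²)·E[‖B‖]. -/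
open MeasureTheory
open scoped ENNReal

noncomputable section

theorem gaussDensity_pos {n : ℕ} {σ : ℝ} (hσ : 0 < σ) (z : EucSp n) :
    0 < gaussDensity σ n z := by
  unfold gaussDensity
  positivity

theorem gaussDensity_le_of_norm_le {n : ℕ} {σ : ℝ} (hσ : 0 < σ) {C : ℝ}
    (hC : C = (2 * Real.pi * σ ^ 2) ^ (-(n : ℝ) / 2)) (z : EucSp n) {R : ℝ}
    (hR : 0 ≤ R) (h : R ≤ ‖z‖) :
    gaussDensity σ n z ≤ C * Real.exp (-R ^ 2 / (2 * σ ^ 2)) := by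
  unfold gaussDensity
  rw [hC]
  gcongr

theorem le_gaussDensity_of_norm_le {n : ℕ} {σ : ℝ} (hσ : 0 < σ) {C : ℝ}
    (hC : C = (2 * Real.pi * σ ^ 2) ^ (-(n : ℝ) / 2)) (z : EucSp n) {R : ℝ}
    (h : ‖z‖ ≤ R) :
    C * Real.exp (-R ^ 2 / (2 * σ ^ 2)) ≤ gaussDensity σ n z := by
  unfold gaussDensity
  rw [hC]
  gcongr

theorem gaussDensity_hasFDerivAt {n : ℕ} {σ : ℝ} (hσ : 0 < σ) (z : EucSp n) :
    HasFDerivAt (gaussDensity σ n) (-(gaussDensity σ n z / σ ^ 2) • innerSL ℝ z) z := by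
  unfold gaussDensity
  have h1 : HasFDerivAt (fun z : EucSp n => ‖z‖ ^ 2) (2 • innerSL ℝ z) z :=
    (hasStrictFDerivAt_norm_sq z).hasFDerivAt
  have h2 := (((h1.neg).mul_const ((2 * σ ^ 2)⁻¹)).exp).const_mul
    ((2 * Real.pi * σ ^ 2) ^ (-(n : ℝ) / 2))
  simp only [div_eq_mul_inv] at h2 ⊢
  refine h2.congr_fderiv ?_
  ext y
  simp
  field_simp

theorem gaussDensity_continuous {n : ℕ} {σ : ℝ} : Continuous (gaussDensity σ n) := by
  unfold gaussDensity
  fun_prop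

theorem regularDensity_aux {n : ℕ} {σ : ℝ} (hσ : 0 < σ) {μB : Measure (EucSp n)}
    [IsProbabilityMeasure μB]
    (hB1 : Integrable (fun b => ‖b‖) μB) (K : EucSp n → ℝ) (C : ℝ)
    (hKpos : ∀ z, 0 < K z) (hKle : ∀ z, K z ≤ C) (hKcont : Continuous K)
    (hKR : ∀ R : ℝ, 0 ≤ R → ∃ e : ℝ, 0 < e ∧ (∀ z, ‖z‖ ≤ R → e ≤ K z) ∧
      ∀ z, R ≤ ‖z‖ → K z ≤ e)
    (hKder : ∀ z, HasFDerivAt K (-(K z / σ ^ 2) • innerSL ℝ z) z) :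
    RegularDensity n (3 / σ ^ 2) (4 / σ ^ 2 * ∫ b, ‖b‖ ∂μB)
      (fun v => ∫ b, K (v - b) ∂μB) := by
  have hKc : ∀ v : EucSp n, Continuous fun b => K (v - b) := fun v =>
    hKcont.comp (by fun_prop)
  have hKint : ∀ v : EucSp n, Integrable (fun b => K (v - b)) μB := fun v =>
    Integrable.of_bound (hKc v).aestronglyMeasurable C
      (Filter.Eventually.of_forall fun b => by
        rw [Real.norm_of_nonneg (hKpos _).le]; exact hKle _)
  have hKBint : ∀ v : EucSp n, Integrable (fun b => ‖b‖ * K (v - b)) μB := by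
    intro v
    refine (hB1.mul_const C).mono' 
      (continuous_norm.mul (hKc v)).aestronglyMeasurable
      (Filter.Eventually.of_forall fun b => ?_)
    rw [Real.norm_of_nonneg (mul_nonneg (norm_nonneg _) (hKpos _).le)]
    exact mul_le_mul_of_nonneg_left (hKle _) (norm_nonneg _)
  have hppos : ∀ v : EucSp n, 0 < ∫ b, K (v - b) ∂μB := by
    intro v
    refine (integral_pos_iff_support_of_nonneg (fun b => (hKpos (v - b)).le) (hKint v)).2 ?_
    have : Function.support (fun b => K (v - b)) = Set.univ := by
      ext b; simp [(hKpos (v - b)).ne']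
    rw [this]; simp
  set F' : EucSp n → EucSp n → (EucSp n →L[ℝ] ℝ) := fun v b =>
    -(K (v - b) / σ ^ 2) • innerSL ℝ (v - b) with hF'
  have hF'norm : ∀ v b, ‖F' v b‖ = K (v - b) / σ ^ 2 * ‖v - b‖ := by
    intro v b
    simp only [hF']
    rw [norm_smul, innerSL_apply_norm, norm_neg,
      Real.norm_of_nonneg (div_nonneg (hKpos _).le (by positivity))]
  have hF'c : ∀ v, Continuous (F' v) := by
    intro v
    have := hKc v
    simp only [hF']
    fun_prop
  have hder : ∀ v, HasFDerivAt (fun v => ∫ b, K (v - b) ∂μB)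
      (∫ b, F' v b ∂μB) v := by
    intro v
    refine hasFDerivAt_integral_of_dominated_of_fderiv_le
      (bound := fun b => C / σ ^ 2 * (‖v‖ + 1 + ‖b‖)) (Metric.ball_mem_nhds v one_pos)
      (Filter.Eventually.of_forall fun x => (hKc x).aestronglyMeasurable) (hKint v)
      (hF'c v).aestronglyMeasurable ?_ ?_ ?_
    · refine Filter.Eventually.of_forall fun b x hx => ?_
      rw [hF'norm]
      have h1 : ‖x - v‖ < 1 := by simpa [dist_eq_norm] using hx
      have h2 : ‖x - b‖ ≤ ‖v‖ + 1 + ‖b‖ := by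
        have := norm_sub_le x b
        have h3 : ‖x‖ ≤ ‖x - v‖ + ‖v‖ := by simpa using norm_add_le (x - v) v
        linarith
      have := hKle (x - b)
      have hC : 0 < C := (hKpos _).trans_le this
      gcongr
    · exact ((integrable_const _).add hB1).const_mul _
    · refine Filter.Eventually.of_forall fun b x _ => ?_
      have h := (hKder (x - b)).comp x
        ((hasFDerivAt_id x).sub_const b)
      exact h
  have hlog : ∀ v, HasFDerivAt (fun v => Real.log (∫ b, K (v - b) ∂μB))
      ((∫ b, K (v - b) ∂μB)⁻¹ • ∫ b, F' v b ∂μB) v :=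
    fun v => (hder v).log (hppos v).ne'
  have hm : 0 ≤ ∫ b, ‖b‖ ∂μB := integral_nonneg fun _ => norm_nonneg _
  refine ⟨by positivity, by positivity, hppos, fun v => (hlog v).differentiableAt, fun v => ?_⟩
  unfold gradient
  rw [(hlog v).fderiv, LinearIsometryEquiv.norm_map, norm_smul, norm_inv,
    Real.norm_of_nonneg (hppos v).le, inv_mul_le_iff₀ (hppos v)]
  set m := ∫ b, ‖b‖ ∂μB with hmdef
  set P := ∫ b, K (v - b) ∂μB with hP
  set R := ‖v‖ + 2 * m with hR
  have hR0 : 0 ≤ R := by positivity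
  obtain ⟨e, hepos, hel, heu⟩ := hKR R hR0
  clear_value R P m
  have hlow : e * m ≤ 2 * m * P := by
    have hpt : ∀ b : EucSp n, e * (2 * m - ‖b‖) ≤ 2 * m * K (v - b) := by
        intro b
        have hk := hKpos (v - b)
        rcases le_total ‖b‖ (2 * m) with hb | hb
        · have h1 : ‖v - b‖ ≤ R := by have := norm_sub_le v b; linarith
          have h2 : e ≤ K (v - b) := hel _ h1
          have h3 := norm_nonneg b
          calc e * (2 * m - ‖b‖) ≤ e * (2 * m) := mul_le_mul_of_nonneg_left (by linarith) hepos.le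
            _ = 2 * m * e := by ring
            _ ≤ _ := mul_le_mul_of_nonneg_left h2 (by positivity)
        · exact (mul_nonpos_of_nonneg_of_nonpos hepos.le (by linarith)).trans (mul_nonneg (mul_nonneg zero_le_two hm) hk.le)
    have h := integral_mono (μ := μB) (f := fun b => e * (2 * m - ‖b‖))
      (g := fun b => 2 * m * K (v - b))
      (((integrable_const (2 * m)).sub hB1).const_mul e) ((hKint v).const_mul (2 * m)) hpt
    rw [integral_const_mul, integral_const_mul, integral_sub (integrable_const _) hB1] at h
    simp at h
    rw [← hmdef, ← hP] at h
    linarith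
  have hup : ∫ b, ‖b‖ * K (v - b) ∂μB ≤ (2 * ‖v‖ + 4 * m) * P := by
    have hpt : ∀ b : EucSp n, ‖b‖ * K (v - b) ≤
        (‖v‖ + R) * K (v - b) + e * ‖b‖ := by
        intro b
        have hk := hKpos (v - b)
        rcases le_total ‖v - b‖ R with hb | hb
        · have h1 : ‖b‖ ≤ ‖v‖ + R := by
            have := norm_sub_le v (v - b)
            rw [sub_sub_cancel] at this
            linarith
          have : ‖b‖ * K (v - b) ≤ (‖v‖ + R) * K (v - b) :=
            mul_le_mul_of_nonneg_right h1 hk.le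
          have : 0 ≤ e * ‖b‖ := by positivity
          linarith
        · have h2 : K (v - b) ≤ e := heu _ hb
          have : ‖b‖ * K (v - b) ≤ ‖b‖ * e :=
            mul_le_mul_of_nonneg_left h2 (norm_nonneg b)
          have : 0 ≤ (‖v‖ + R) * K (v - b) :=
            mul_nonneg (add_nonneg (norm_nonneg v) hR0) hk.le
          linarith
    have h := integral_mono (μ := μB) (f := fun b => ‖b‖ * K (v - b))
      (g := fun b => (‖v‖ + R) * K (v - b) + e * ‖b‖)
      (hKBint v) (((hKint v).const_mul (‖v‖ + R)).add (hB1.const_mul e)) hpt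
    rw [integral_add ((hKint v).const_mul _) (hB1.const_mul _), integral_const_mul,
      integral_const_mul, ← hmdef, ← hP] at h
    calc _ ≤ _ := h
      _ ≤ (‖v‖ + R) * P + 2 * m * P := by linarith
      _ = _ := by rw [hR]; ring
  have hbd : ‖∫ b, F' v b ∂μB‖ ≤
      ∫ b, (σ ^ 2)⁻¹ * (‖v‖ * K (v - b) + ‖b‖ * K (v - b)) ∂μB := by
    refine norm_integral_le_of_norm_le
      ((((hKint v).const_mul _).add (hKBint v)).const_mul _)
      (Filter.Eventually.of_forall fun b => ?_)
    rw [hF'norm]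
    have hk := hKpos (v - b)
    calc K (v - b) / σ ^ 2 * ‖v - b‖
        ≤ K (v - b) / σ ^ 2 * (‖v‖ + ‖b‖) := by
          exact mul_le_mul_of_nonneg_left (norm_sub_le v b) (div_nonneg hk.le (by positivity))
      _ = _ := by ring
  rw [integral_const_mul, integral_add ((hKint v).const_mul _) (hKBint v),
    integral_const_mul, ← hP] at hbd
  calc _ ≤ _ := hbd
    _ ≤ (σ ^ 2)⁻¹ * (‖v‖ * P + (2 * ‖v‖ + 4 * m) * P) := by gcongr
    _ = _ := by ring

/-- Let `V = B + Z` with `B ⟂ Z`, `Z ∼ N(0, σ²Iₙ)` and `E[‖B‖] < ∞`. Then the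
density of `V`, namely `v ↦ E[p_Z(v − B)]`, is `(c₁,c₂)`-regular with `c₁ = 3/σ²` and
`c₂ = (4/σ²) E[‖B‖]`. -/
theorem stmt6 {n : ℕ} {σ : ℝ} (hσ : 0 < σ) {μB : Measure (EucSp n)}
    [IsProbabilityMeasure μB]
    (hB1 : Integrable (fun b => ‖b‖) μB) :
    RegularDensity n (3 / σ ^ 2) (4 / σ ^ 2 * ∫ b, ‖b‖ ∂μB)
      (fun v => ∫ b, gaussDensity σ n (v - b) ∂μB) := by
  refine regularDensity_aux hσ hB1 (gaussDensity σ n)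
    ((2 * Real.pi * σ ^ 2) ^ (-(n : ℝ) / 2)) (gaussDensity_pos hσ) (fun z => ?_)
    gaussDensity_continuous (fun R hR => ⟨(2 * Real.pi * σ ^ 2) ^ (-(n : ℝ) / 2) *
      Real.exp (-R ^ 2 / (2 * σ ^ 2)), by positivity,
      fun z hz => le_gaussDensity_of_norm_le hσ rfl z hz,
      fun z hz => gaussDensity_le_of_norm_le hσ rfl z hR hz⟩)
    (gaussDensity_hasFDerivAt hσ)
  simpa using gaussDensity_le_of_norm_le hσ rfl z le_rfl (norm_nonneg z)
end
end

section
/- Let B and Z be independent random vectors in ℝⁿ with Z ∼ N(0, σ²Iₙ) Gaussian and E[‖B‖] < ∞, and set V = B + Z with density p_V(v) = E[p_Z(v − B)]. Then for every v ∈ ℝⁿ, the conditional expectation E[‖B − v‖ | V = v] = E[‖B − v‖ · p_Z(v − B)] / p_V(v) satisfies E[‖B − v‖ | V = v] ≤ 3‖v‖ + 4·E[‖B‖]. -/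
open MeasureTheory
open scoped ENNReal

noncomputable section

/-- Let `B ⟂ Z`, `Z ∼ N(0, σ²Iₙ)`, `E[‖B‖] < ∞`, and `V = B + Z` with density
`p_V(v) = E[p_Z(v − B)]`. Then for every `v`, the conditional expectation
`E[‖B − v‖ | V = v] = E[‖B − v‖ p_Z(v − B)] / p_V(v)` is at most `3‖v‖ + 4E[‖B‖]`. -/
theorem stmt7 {n : ℕ} {σ : ℝ} (hσ : 0 < σ) {μB : Measure (EucSp n)}
    [IsProbabilityMeasure μB]
    (hB1 : Integrable (fun b => ‖b‖) μB) (v : EucSp n) :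
    (∫ b, ‖b - v‖ * gaussDensity σ n (v - b) ∂μB) / (∫ b, gaussDensity σ n (v - b) ∂μB) ≤
      3 * ‖v‖ + 4 * ∫ b, ‖b‖ ∂μB := by
  set C : ℝ := (2 * Real.pi * σ ^ 2) ^ (-(n : ℝ) / 2) with hC
  have hCpos : 0 < C := by positivity
  set g : ℝ → ℝ := fun r => C * Real.exp (-r ^ 2 / (2 * σ ^ 2)) with hg
  have hgd : ∀ b : EucSp n, gaussDensity σ n (v - b) = g ‖b - v‖ := by
    intro b
    simp only [gaussDensity, hg, hC, norm_sub_rev v b]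
  simp only [hgd]
  have hgpos : ∀ r, 0 < g r := fun r => by simp only [hg]; positivity
  have hgle : ∀ r, g r ≤ C := by
    intro r
    have h1 : Real.exp (-r ^ 2 / (2 * σ ^ 2)) ≤ 1 := by
      rw [Real.exp_le_one_iff]
      apply div_nonpos_of_nonpos_of_nonneg
      · nlinarith [sq_nonneg r]
      · positivity
    simp only [hg]
    nlinarith
  have hanti : ∀ r s, 0 ≤ r → r ≤ s → g s ≤ g r := by
    intro r s hr hrs
    simp only [hg]
    gcongr
  have hgc : Continuous g := by simp only [hg]; fun_prop
  clear_value g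
  have hm : AEStronglyMeasurable (fun b : EucSp n => g ‖b - v‖) μB :=
    (hgc.comp (by fun_prop : Continuous fun b : EucSp n => ‖b - v‖)).aestronglyMeasurable
  have hbd : ∀ᵐ b ∂μB, ‖g ‖b - v‖‖ ≤ C := by
    refine Filter.Eventually.of_forall fun b => ?_
    rw [Real.norm_of_nonneg (hgpos _).le]
    exact hgle _
  have hgi : Integrable (fun b : EucSp n => g ‖b - v‖) μB :=
    (integrable_const C).mono' hm hbd
  have hri : Integrable (fun b : EucSp n => ‖b - v‖) μB := by
    refine (hB1.add (integrable_const ‖v‖)).mono'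
      (by fun_prop : Continuous fun b : EucSp n => ‖b - v‖).aestronglyMeasurable ?_
    refine Filter.Eventually.of_forall fun b => ?_
    rw [norm_norm]
    exact norm_sub_le b v
  have hrg : Integrable (fun b : EucSp n => ‖b - v‖ * g ‖b - v‖) μB :=
    hri.mul_bdd hm hbd
  set m : ℝ := ∫ b, ‖b - v‖ ∂μB with hmdef
  have hm0 : 0 ≤ m := integral_nonneg fun b => norm_nonneg _
  have hmle : m ≤ ∫ b, ‖b‖ ∂μB + ‖v‖ := by
    have h := integral_mono hri (hB1.add (integrable_const ‖v‖)) fun b => norm_sub_le b v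
    have h2 : ∫ b, (‖b‖ + ‖v‖) ∂μB = (∫ b, ‖b‖ ∂μB) + ‖v‖ := by
      rw [integral_add hB1 (integrable_const _)]
      simp
    exact h.trans_eq h2
  have hB0 : 0 ≤ ∫ b, ‖b‖ ∂μB := integral_nonneg fun b => norm_nonneg _
  have hpt : ∀ b : EucSp n,
      ‖b - v‖ * g ‖b - v‖ ≤ m * g ‖b - v‖ + g m * (‖b - v‖ - m) := by
    intro b
    rcases le_total ‖b - v‖ m with h | h
    · nlinarith [hanti _ _ (norm_nonneg (b - v)) h]
    · nlinarith [hanti _ _ hm0 h]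
  have hi1 : Integrable (fun b : EucSp n => m * g ‖b - v‖) μB := hgi.const_mul m
  have hi2 : Integrable (fun b : EucSp n => g m * (‖b - v‖ - m)) μB :=
    (hri.sub (integrable_const m)).const_mul (g m)
  have hmain : ∫ b, ‖b - v‖ * g ‖b - v‖ ∂μB ≤ m * ∫ b, g ‖b - v‖ ∂μB := by
    have h := integral_mono hrg (hi1.add hi2) hpt
    have h2 : ∫ b, (m * g ‖b - v‖ + g m * (‖b - v‖ - m)) ∂μB
        = m * ∫ b, g ‖b - v‖ ∂μB := by
      rw [integral_add hi1 hi2, integral_const_mul, integral_const_mul,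
        integral_sub hri (integrable_const m), ← hmdef]
      simp
    exact h.trans_eq h2
  have hG0 : 0 ≤ ∫ b, g ‖b - v‖ ∂μB := integral_nonneg fun b => (hgpos _).le
  have := div_le_of_le_mul₀ hG0 hm0 hmain
  linarith [norm_nonneg v]
end
end

section
/- Let W be a random vector in ℝⁿ with a (c₁,c₂)-regular density, and let B be a random vector in ℝⁿ independent of W with ‖B‖ ≤ √(nP) almost surely, for some P > 0. Then V = B + W has a (c₁, c₂ + c₁·√(nP))-regular density. -/
open MeasureTheory
open scoped ENNReal

noncomputable section

/-- If `W` has a `(c₁,c₂)`-regular density `pW` and `B ⟂ W` satisfies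
`‖B‖ ≤ √(nP)` a.s. for some `P > 0`, then `V = B + W` has a `(c₁, c₂ + c₁√(nP))`-regular
density `v ↦ E[pW(v − B)]`. -/
theorem stmt8 {n : ℕ} {c₁ c₂ P : ℝ} (hP : 0 < P) {pW : EucSp n → ℝ} {μB : Measure (EucSp n)}
    [IsProbabilityMeasure μB]
    (hreg : RegularDensity n c₁ c₂ pW)
    (hpdf : ∫ x, pW x = 1)
    (hBbd : ∀ᵐ b ∂μB, ‖b‖ ≤ Real.sqrt (n * P)) :
    RegularDensity n c₁ (c₂ + c₁ * Real.sqrt (n * P)) (fun v => ∫ b, pW (v - b) ∂μB) := by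
  obtain ⟨h1, h2, hpos, hdiff, hgrad⟩ := hreg
  set R := Real.sqrt (n * P) with hR
  have hR0 : 0 ≤ R := Real.sqrt_nonneg _
  -- differentiability of the density itself
  have hexp : (fun x => Real.exp (Real.log (pW x))) = pW := by
    funext x
    exact Real.exp_log (hpos x)
  have hpd : Differentiable ℝ pW := by
    have := hdiff.exp
    rwa [hexp] at this
  have hpc : Continuous pW := hpd.continuous
  have hfd : ∀ x, ‖fderiv ℝ pW x‖ ≤ pW x * (c₁ * ‖x‖ + c₂) := by
    intro x
    have e1 : fderiv ℝ (fun y => Real.log (pW y)) x = (pW x)⁻¹ • fderiv ℝ pW x :=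
      ((hpd x).hasFDerivAt.log (hpos x).ne').fderiv
    have e2 := hgrad x
    rw [gradient, LinearIsometryEquiv.norm_map, e1, norm_smul, norm_inv, Real.norm_eq_abs,
      abs_of_pos (hpos x)] at e2
    rwa [inv_mul_le_iff₀ (hpos x)] at e2
  have hmeas : ∀ x : EucSp n, AEStronglyMeasurable (fun b => pW (x - b)) μB := fun x =>
    (hpc.comp (continuous_const.sub continuous_id)).aestronglyMeasurable
  have hmeas' : ∀ x : EucSp n, AEStronglyMeasurable (fun b => fderiv ℝ pW (x - b)) μB := fun x =>
    ((measurable_fderiv ℝ pW).comp (measurable_const.sub measurable_id)).aestronglyMeasurable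
  have hM : ∀ r : ℝ, ∃ M, 0 ≤ M ∧ ∀ y : EucSp n, ‖y‖ ≤ r → pW y ≤ M := by
    intro r
    obtain ⟨M, hM⟩ := (isCompact_closedBall (0 : EucSp n) r).exists_bound_of_continuousOn
      hpc.continuousOn
    refine ⟨max M 0, le_max_right _ _, fun y hy => ?_⟩
    have := hM y (by simpa using hy)
    exact ((le_abs_self _).trans this).trans (le_max_left _ _)
  have hint : ∀ x : EucSp n, Integrable (fun b => pW (x - b)) μB := by
    intro x
    obtain ⟨M, -, hM⟩ := hM (‖x‖ + R)
    refine Integrable.of_bound (hmeas x) M ?_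
    filter_upwards [hBbd] with b hb
    rw [Real.norm_eq_abs, abs_of_pos (hpos _)]
    exact hM _ ((norm_sub_le _ _).trans (by linarith))
  have hVpos : ∀ x : EucSp n, 0 < ∫ b, pW (x - b) ∂μB := by
    intro x
    rw [integral_pos_iff_support_of_nonneg (fun b => (hpos _).le) (hint x)]
    have : Function.support (fun b => pW (x - b)) = Set.univ := by
      ext b
      simp [(hpos (x - b)).ne']
    rw [this]
    simp
  have hder : ∀ x : EucSp n, HasFDerivAt (fun v => ∫ b, pW (v - b) ∂μB)
      (∫ b, fderiv ℝ pW (x - b) ∂μB) x := by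
    intro x
    obtain ⟨M, hM0, hM⟩ := hM (‖x‖ + 1 + R)
    refine hasFDerivAt_integral_of_dominated_of_fderiv_le
      (F := fun v b => pW (v - b)) (F' := fun v b => fderiv ℝ pW (v - b))
      (bound := fun _ => M * (c₁ * (‖x‖ + 1 + R) + c₂))
      (Metric.ball_mem_nhds x one_pos) (Filter.Eventually.of_forall hmeas) (hint x) (hmeas' x)
      ?_ (integrable_const _) ?_
    · filter_upwards [hBbd] with b hb v hv
      have hv' : ‖v‖ ≤ ‖x‖ + 1 := by
        have h3 : ‖v - x‖ < 1 := by simpa [dist_eq_norm] using hv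
        have h4 := norm_add_le x (v - x)
        rw [add_sub_cancel] at h4
        linarith
      have hvb : ‖v - b‖ ≤ ‖x‖ + 1 + R := (norm_sub_le _ _).trans (by linarith)
      refine (hfd _).trans ?_
      have := hM _ hvb
      gcongr
    · refine Filter.Eventually.of_forall fun b v _ => ?_
      simpa [Function.comp_def] using (hpd (v - b)).hasFDerivAt.comp v ((hasFDerivAt_id v).sub_const b)
  refine ⟨h1, by positivity, hVpos, fun x => ((hder x).log (hVpos x).ne').differentiableAt, ?_⟩
  intro x
  rw [gradient, LinearIsometryEquiv.norm_map, ((hder x).log (hVpos x).ne').fderiv, norm_smul,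
    norm_inv, Real.norm_eq_abs, abs_of_pos (hVpos x), inv_mul_le_iff₀ (hVpos x),
    ← integral_mul_const]
  refine norm_integral_le_of_norm_le ((hint x).mul_const _) ?_
  filter_upwards [hBbd] with b hb
  refine (hfd _).trans ?_
  have h3 : ‖x - b‖ ≤ ‖x‖ + R := (norm_sub_le _ _).trans (by linarith)
  have h4 : c₁ * ‖x - b‖ ≤ c₁ * (‖x‖ + R) := mul_le_mul_of_nonneg_left h3 h1.le
  exact mul_le_mul_of_nonneg_left (by linarith) (hpos _).le
end
end

section
/- Let X, X̃, Z be random vectors in ℝⁿ with Z ∼ N(0, σ²Iₙ) Gaussian, Z independent of X and of X̃, and E[‖X‖²] ≤ nP, E[‖X̃‖²] ≤ nP. Then |h(X + Z) − h(X̃ + Z)| ≤ Δ, where Δ = (1/σ²)·(3√(n(σ² + P)) + 4√(nP)) · W₂(P_{X+Z}, P_{X̃+Z}). -/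
open MeasureTheory
open scoped ENNReal

noncomputable section

lemma gd_pos {σ : ℝ} (hσ : 0 < σ) (n : ℕ) (z : EucSp n) : 0 < gaussDensity σ n z := by
  unfold gaussDensity; positivity

lemma gd_cont (σ : ℝ) (n : ℕ) : Continuous (gaussDensity σ n) := by
  unfold gaussDensity; fun_prop

lemma gd_le {σ : ℝ} (hσ : 0 < σ) (n : ℕ) (z : EucSp n) :
    gaussDensity σ n z ≤ (2 * Real.pi * σ ^ 2) ^ (-(n : ℝ) / 2) := by
  unfold gaussDensity
  have h1 : Real.exp (-‖z‖ ^ 2 / (2 * σ ^ 2)) ≤ 1 := by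
    rw [Real.exp_le_one_iff]
    apply div_nonpos_of_nonpos_of_nonneg <;> [nlinarith [sq_nonneg ‖z‖]; positivity]
  have h2 : 0 ≤ (2 * Real.pi * σ ^ 2) ^ (-(n : ℝ) / 2) := by positivity
  nlinarith

/-- the output density -/
def pdens (σ : ℝ) (n : ℕ) (μ : Measure (EucSp n)) (v : EucSp n) : ℝ :=
  ∫ x, gaussDensity σ n (v - x) ∂μ

lemma gd_int {σ : ℝ} (hσ : 0 < σ) {n : ℕ} (μ : Measure (EucSp n)) [IsProbabilityMeasure μ]
    (v : EucSp n) : Integrable (fun x => gaussDensity σ n (v - x)) μ := by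
  refine Integrable.of_bound (C := (2 * Real.pi * σ ^ 2) ^ (-(n : ℝ) / 2)) ?_ ?_
  · exact ((gd_cont σ n).comp (by fun_prop)).aestronglyMeasurable
  · refine Filter.Eventually.of_forall fun x => ?_
    rw [Real.norm_of_nonneg (gd_pos hσ n _).le]
    exact gd_le hσ n _

lemma pdens_pos {σ : ℝ} (hσ : 0 < σ) {n : ℕ} (μ : Measure (EucSp n)) [IsProbabilityMeasure μ]
    (v : EucSp n) : 0 < pdens σ n μ v := by
  unfold pdens
  rw [integral_pos_iff_support_of_nonneg (fun x => (gd_pos hσ n _).le) (gd_int hσ μ v)]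
  have : (Function.support fun x => gaussDensity σ n (v - x)) = Set.univ := by
    ext x; simp [(gd_pos hσ n (v - x)).ne']
  rw [this]; simp

lemma pdens_le {σ : ℝ} (hσ : 0 < σ) {n : ℕ} (μ : Measure (EucSp n)) [IsProbabilityMeasure μ]
    (v : EucSp n) : pdens σ n μ v ≤ (2 * Real.pi * σ ^ 2) ^ (-(n : ℝ) / 2) := by
  unfold pdens
  calc _ ≤ ∫ x, (2 * Real.pi * σ ^ 2) ^ (-(n : ℝ) / 2) ∂μ :=
        integral_mono (gd_int hσ μ v) (integrable_const _) (fun x => gd_le hσ n _)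
    _ = _ := by simp

lemma pdens_meas {σ : ℝ} {n : ℕ} (μ : Measure (EucSp n)) [IsProbabilityMeasure μ] :
    Measurable (pdens σ n μ) := by
  unfold pdens
  have : StronglyMeasurable (fun p : EucSp n × EucSp n => gaussDensity σ n (p.1 - p.2)) :=
    ((gd_cont σ n).comp (by fun_prop)).stronglyMeasurable
  exact this.integral_prod_right.measurable

lemma gd_ptwise {σ : ℝ} (hσ : 0 < σ) {n : ℕ} (u v x : EucSp n) (m : ℝ) (hm : 0 ≤ m) :
    Real.exp (-(‖u - v‖ ^ 2 / (2 * σ ^ 2) + ‖u - v‖ / σ ^ 2 * m)) *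
      (gaussDensity σ n (v - x) - ‖u - v‖ / σ ^ 2 *
        ((2 * Real.pi * σ ^ 2) ^ (-(n : ℝ) / 2) * Real.exp (-m ^ 2 / (2 * σ ^ 2))) *
          (‖v - x‖ - m)) ≤ gaussDensity σ n (u - x) := by
  unfold gaussDensity
  set c := (2 * Real.pi * σ ^ 2) ^ (-(n : ℝ) / 2) with hc
  have hc0 : 0 ≤ c := by rw [hc]; positivity
  set d := ‖u - v‖
  set T := ‖v - x‖
  have hd : 0 ≤ d := norm_nonneg _
  have hT : 0 ≤ T := norm_nonneg _
  set b := d / σ ^ 2 with hb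
  have hb0 : 0 ≤ b := by positivity
  have htri : ‖u - x‖ ≤ d + T := by
    have := norm_add_le (u - v) (v - x)
    simpa using this
  have h1 : Real.exp (-(d ^ 2 / (2 * σ ^ 2) + b * T + T ^ 2 / (2 * σ ^ 2))) ≤
      Real.exp (-‖u - x‖ ^ 2 / (2 * σ ^ 2)) := by
    apply Real.exp_le_exp.2
    have : d ^ 2 / (2 * σ ^ 2) + b * T + T ^ 2 / (2 * σ ^ 2) = (d + T) ^ 2 / (2 * σ ^ 2) := by
      rw [hb]; field_simp; ring
    rw [this, neg_div]
    apply neg_le_neg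
    gcongr
  have h2 : Real.exp (-(d ^ 2 / (2 * σ ^ 2) + b * T + T ^ 2 / (2 * σ ^ 2))) =
      Real.exp (-(d ^ 2 / (2 * σ ^ 2) + b * m)) *
        (Real.exp (-T ^ 2 / (2 * σ ^ 2)) * Real.exp (-(b * (T - m)))) := by
    rw [← Real.exp_add, ← Real.exp_add]; congr 1; ring
  have h3 : 1 - b * (T - m) ≤ Real.exp (-(b * (T - m))) := by
    have := Real.add_one_le_exp (-(b * (T - m))); linarith
  have h4 : Real.exp (-T ^ 2 / (2 * σ ^ 2)) * (T - m) ≤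
      Real.exp (-m ^ 2 / (2 * σ ^ 2)) * (T - m) := by
    rcases le_total m T with h | h
    · apply mul_le_mul_of_nonneg_right _ (by linarith)
      apply Real.exp_le_exp.2
      gcongr
    · apply mul_le_mul_of_nonpos_right _ (by linarith)
      apply Real.exp_le_exp.2
      gcongr
  have h5 : Real.exp (-T ^ 2 / (2 * σ ^ 2)) - b * (Real.exp (-m ^ 2 / (2 * σ ^ 2)) * (T - m)) ≤
      Real.exp (-T ^ 2 / (2 * σ ^ 2)) * Real.exp (-(b * (T - m))) := by
    have e1 := mul_le_mul_of_nonneg_left h3 (Real.exp_pos (-T ^ 2 / (2 * σ ^ 2))).le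
    have e2 := mul_le_mul_of_nonneg_left h4 hb0
    nlinarith
  calc _ = c * (Real.exp (-(d ^ 2 / (2 * σ ^ 2) + b * m)) * (Real.exp (-T ^ 2 / (2 * σ ^ 2)) -
        b * (Real.exp (-m ^ 2 / (2 * σ ^ 2)) * (T - m)))) := by ring
    _ ≤ c * (Real.exp (-(d ^ 2 / (2 * σ ^ 2) + b * m)) *
        (Real.exp (-T ^ 2 / (2 * σ ^ 2)) * Real.exp (-(b * (T - m))))) := by gcongr
    _ = c * Real.exp (-(d ^ 2 / (2 * σ ^ 2) + b * T + T ^ 2 / (2 * σ ^ 2))) := by rw [h2]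
    _ ≤ _ := by gcongr

lemma key {σ : ℝ} (hσ : 0 < σ) {n : ℕ} (μ : Measure (EucSp n)) [IsProbabilityMeasure μ]
    (hμ : Integrable (fun x => ‖x‖) μ) (u v : EucSp n) :
    Real.log (pdens σ n μ v) - Real.log (pdens σ n μ u) ≤
      ‖u - v‖ ^ 2 / (2 * σ ^ 2) + ‖u - v‖ / σ ^ 2 * (‖v‖ + ∫ x, ‖x‖ ∂μ) := by
  have hTi : Integrable (fun x => ‖v - x‖) μ := by
    have h : Integrable (fun x : EucSp n => x) μ :=
      (integrable_norm_iff (by fun_prop)).1 hμ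
    exact ((integrable_const v).sub h).norm
  set m := ∫ x, ‖v - x‖ ∂μ with hm
  have hm0 : 0 ≤ m := integral_nonneg fun x => norm_nonneg _
  have hm1 : m ≤ ‖v‖ + ∫ x, ‖x‖ ∂μ := by
    calc m ≤ ∫ x, (‖v‖ + ‖x‖) ∂μ :=
          integral_mono hTi ((integrable_const _).add hμ) (fun x => norm_sub_le _ _)
      _ = _ := by rw [integral_add (integrable_const _) hμ]; simp
  set A := ‖u - v‖ ^ 2 / (2 * σ ^ 2) + ‖u - v‖ / σ ^ 2 * m with hA
  have hmain : Real.exp (-A) * pdens σ n μ v ≤ pdens σ n μ u := by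
    set B := ‖u - v‖ / σ ^ 2 *
        ((2 * Real.pi * σ ^ 2) ^ (-(n : ℝ) / 2) * Real.exp (-m ^ 2 / (2 * σ ^ 2))) with hB
    have hi2 : Integrable (fun x => B * (‖v - x‖ - m)) μ :=
      (hTi.sub (integrable_const m)).const_mul B
    have h := integral_mono (((gd_int hσ μ v).sub hi2).const_mul (Real.exp (-A)))
      (gd_int hσ μ u) (fun x => gd_ptwise hσ u v x m hm0)
    simp only [Pi.sub_apply] at h
    rw [integral_const_mul, integral_sub (gd_int hσ μ v) hi2, integral_const_mul,
      integral_sub hTi (integrable_const m), ← hm] at h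
    simpa [pdens] using h
  have hlog := Real.log_le_log (mul_pos (Real.exp_pos _) (pdens_pos hσ μ v)) hmain
  rw [Real.log_mul (Real.exp_pos _).ne' (pdens_pos hσ μ v).ne', Real.log_exp] at hlog
  have : A ≤ ‖u - v‖ ^ 2 / (2 * σ ^ 2) + ‖u - v‖ / σ ^ 2 * (‖v‖ + ∫ x, ‖x‖ ∂μ) := by
    rw [hA]; gcongr
  linarith

lemma gd_eq {σ : ℝ} (hσ : 0 < σ) (n : ℕ) (z : EucSp n) : gaussDensity σ n z =
    (2 * Real.pi * σ ^ 2) ^ (-(n : ℝ) / 2) * Real.exp (-(1 / (2 * σ ^ 2)) * ‖z‖ ^ 2) := by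
  unfold gaussDensity; congr 2; field_simp

lemma expsq_int {n : ℕ} {b : ℝ} (hb : 0 < b) :
    Integrable (fun z : EucSp n => Real.exp (-b * ‖z‖ ^ 2)) := by
  have h := GaussianFourier.integrable_cexp_neg_mul_sq_norm_add (V := EucSp n) (b := (b : ℂ))
    (by simpa using hb) 0 0
  have h2 := h.norm
  refine h2.congr (Filter.Eventually.of_forall fun z => ?_)
  simp only [Complex.norm_exp]
  congr 1
  simp [← Complex.ofReal_pow, ← Complex.ofReal_mul, ← Complex.ofReal_neg]

lemma expsq_integral {n : ℕ} {σ e : ℝ} (hσ : 0 < σ) (he : e < 1) :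
    (2 * Real.pi * σ ^ 2) ^ (-(n : ℝ) / 2) *
      ∫ z : EucSp n, Real.exp (-((1 - e) * (1 / (2 * σ ^ 2))) * ‖z‖ ^ 2) =
      (1 - e) ^ (-(n : ℝ) / 2) := by
  have h1 : 0 < 1 - e := by linarith
  rw [GaussianFourier.integral_rexp_neg_mul_sq_norm (by positivity)]
  have : Real.pi / ((1 - e) * (1 / (2 * σ ^ 2))) = (2 * Real.pi * σ ^ 2) * (1 - e)⁻¹ := by
    field_simp
  rw [this, Real.mul_rpow (x := 2 * Real.pi * σ ^ 2) (by positivity) (by positivity), ← mul_assoc,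
    ← Real.rpow_add (by positivity), Real.inv_rpow h1.le, neg_div, Real.rpow_neg h1.le]
  simp

lemma gd_vint {σ : ℝ} (hσ : 0 < σ) (n : ℕ) : Integrable (gaussDensity σ n) := by
  have : gaussDensity σ n = fun z => (2 * Real.pi * σ ^ 2) ^ (-(n : ℝ) / 2) *
      Real.exp (-(1 / (2 * σ ^ 2)) * ‖z‖ ^ 2) := funext (gd_eq hσ n)
  rw [this]
  exact (expsq_int (by positivity)).const_mul _

lemma gd_integral {σ : ℝ} (hσ : 0 < σ) (n : ℕ) : ∫ z, gaussDensity σ n z = 1 := by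
  have := expsq_integral (n := n) (e := 0) hσ (by norm_num)
  simp_rw [gd_eq hσ n, integral_const_mul]
  simpa using this

instance gm_prob {σ : ℝ} [hσ : Fact (0 < σ)] (n : ℕ) : IsProbabilityMeasure (gaussMeasure σ n) := by
  constructor
  unfold gaussMeasure
  rw [withDensity_apply _ MeasurableSet.univ, Measure.restrict_univ,
    ← ofReal_integral_eq_lintegral_ofReal (gd_vint hσ.out n)
      (Filter.Eventually.of_forall fun z => (gd_pos hσ.out n z).le), gd_integral hσ.out]
  simp

lemma gm_moment {σ : ℝ} (hσ : 0 < σ) (n : ℕ) :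
    Integrable (fun z => ‖z‖ ^ 2) (gaussMeasure σ n) ∧
    ∫ z, ‖z‖ ^ 2 ∂(gaussMeasure σ n) ≤ 9 / 8 * (n * σ ^ 2) := by
  have : Fact (0 < σ) := ⟨hσ⟩
  rcases Nat.eq_zero_or_pos n with rfl | hn
  · have : (fun z : EucSp 0 => ‖z‖ ^ 2) = fun _ => 0 := by
      ext z; simp [Subsingleton.elim z 0]
    rw [this]; simp
  have hn' : (1 : ℝ) ≤ n := by exact_mod_cast hn
  set e : ℝ := (39 / 400) / n with he
  have he0 : 0 < e := by positivity
  have he1 : e ≤ 39 / 400 := by rw [he]; exact div_le_self (by norm_num) hn'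
  set c := (2 * Real.pi * σ ^ 2) ^ (-(n : ℝ) / 2) with hc
  have hc0 : 0 < c := by rw [hc]; positivity
  set b := 1 / (2 * σ ^ 2) with hb
  have hb0 : 0 < b := by rw [hb]; positivity
  have hpt : ∀ z : EucSp n, gaussDensity σ n z * ‖z‖ ^ 2 ≤
      (e * b)⁻¹ * (c * Real.exp (-((1 - e) * b) * ‖z‖ ^ 2) - gaussDensity σ n z) := by
    intro z
    rw [gd_eq hσ n z, ← hc, ← hb]
    have h1 : Real.exp (-((1 - e) * b) * ‖z‖ ^ 2) =
        Real.exp (-b * ‖z‖ ^ 2) * Real.exp (e * b * ‖z‖ ^ 2) := by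
      rw [← Real.exp_add]; congr 1; ring
    have h2 := Real.add_one_le_exp (e * b * ‖z‖ ^ 2)
    have h3 : 0 < e * b := by positivity
    rw [h1, ← div_eq_inv_mul, le_div_iff₀ h3]
    have h4 := mul_le_mul_of_nonneg_left h2 (mul_pos hc0 (Real.exp_pos (-b * ‖z‖ ^ 2))).le
    nlinarith
  have hRint : Integrable (fun z : EucSp n => (e * b)⁻¹ *
      (c * Real.exp (-((1 - e) * b) * ‖z‖ ^ 2) - gaussDensity σ n z)) :=
    (((expsq_int (mul_pos (by linarith) hb0)).const_mul c).sub (gd_vint hσ n)).const_mul _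
  have hLint : Integrable (fun z : EucSp n => gaussDensity σ n z * ‖z‖ ^ 2) := by
    refine hRint.mono' ?_ ?_
    · have := gd_cont σ n
      exact Continuous.aestronglyMeasurable (by fun_prop)
    · refine Filter.Eventually.of_forall fun z => ?_
      rw [Real.norm_of_nonneg (mul_nonneg (gd_pos hσ n z).le (by positivity))]
      exact hpt z
  have hmeas : Measurable fun z => ENNReal.ofReal (gaussDensity σ n z) :=
    (gd_cont σ n).measurable.ennreal_ofReal
  constructor
  · unfold gaussMeasure
    rw [integrable_withDensity_iff hmeas (by simp)]
    refine hLint.congr (Filter.Eventually.of_forall fun z => ?_)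
    simp only [ENNReal.toReal_ofReal (gd_pos hσ n z).le]; ring
  · unfold gaussMeasure
    rw [integral_withDensity_eq_integral_toReal_smul hmeas (by simp)]
    have h0 : ∀ z : EucSp n, (ENNReal.ofReal (gaussDensity σ n z)).toReal • ‖z‖ ^ 2 =
        gaussDensity σ n z * ‖z‖ ^ 2 := by
      intro z; rw [ENNReal.toReal_ofReal (gd_pos hσ n z).le, smul_eq_mul]
    simp_rw [h0]
    have h := integral_mono hLint hRint hpt
    rw [integral_const_mul, integral_sub ((expsq_int (mul_pos (by linarith) hb0)).const_mul c)
      (gd_vint hσ n), gd_integral hσ, integral_const_mul, hc, hb,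
      expsq_integral hσ (by linarith)] at h
    refine h.trans ?_
    have h5 : (1 - e) ^ (-(n : ℝ) / 2) ≤ (19 / 20)⁻¹ := by
      rw [neg_div, Real.rpow_neg (by linarith)]
      apply inv_anti₀ (by norm_num)
      have hbern := one_add_mul_le_pow (a := -e) (by linarith) n
      have h6 : 1 + (n : ℝ) * -e = (19 / 20) ^ 2 := by rw [he]; field_simp; norm_num
      rw [h6] at hbern
      have h7 : ((1 - e) ^ ((n : ℝ) / 2)) ^ 2 = (1 + -e) ^ n := by
        rw [← Real.rpow_natCast, ← Real.rpow_mul (by linarith), ← sub_eq_add_neg]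
        rw [← Real.rpow_natCast]; congr 1; push_cast; ring
      rw [← h7] at hbern
      exact le_of_sq_le_sq hbern (Real.rpow_nonneg (by linarith) _)
    have h8 : (e * (1 / (2 * σ ^ 2)))⁻¹ = n * σ ^ 2 * (800 / 39) := by
      rw [he]; field_simp; norm_num
    rw [h8]
    have h9 : 0 < n * σ ^ 2 := by positivity
    nlinarith

lemma conv_eq {σ : ℝ} (hσ : 0 < σ) {n : ℕ} (μ : Measure (EucSp n)) [IsProbabilityMeasure μ] :
    convMeasure μ (gaussMeasure σ n) =
      volume.withDensity fun v => ENNReal.ofReal (pdens σ n μ v) := by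
  have : Fact (0 < σ) := ⟨hσ⟩
  have hmeas : Measurable fun z => ENNReal.ofReal (gaussDensity σ n z) :=
    (gd_cont σ n).measurable.ennreal_ofReal
  ext s hs
  unfold convMeasure
  have hadd : Measurable fun p : EucSp n × EucSp n => p.1 + p.2 := by fun_prop
  rw [Measure.map_apply hadd hs, Measure.prod_apply (hadd hs), withDensity_apply _ hs]
  have h1 : ∀ x : EucSp n, gaussMeasure σ n (Prod.mk x ⁻¹' ((fun p => p.1 + p.2) ⁻¹' s)) =
      ∫⁻ v in s, ENNReal.ofReal (gaussDensity σ n (v - x)) := by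
    intro x
    have hxs : MeasurableSet (Prod.mk x ⁻¹' ((fun p : EucSp n × EucSp n => p.1 + p.2) ⁻¹' s)) :=
      measurable_prodMk_left (hadd hs)
    unfold gaussMeasure
    rw [withDensity_apply _ hxs, ← lintegral_indicator hxs, ← lintegral_indicator hs]
    conv_rhs => rw [← lintegral_add_left_eq_self _ x]
    congr 1; ext z
    simp only [Set.indicator, add_sub_cancel_left]
    rfl
  simp_rw [h1]
  rw [lintegral_lintegral_swap]
  · refine lintegral_congr fun v => ?_
    rw [pdens, ofReal_integral_eq_lintegral_ofReal (gd_int hσ μ v)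
      (Filter.Eventually.of_forall fun z => (gd_pos hσ n _).le)]
  · exact Measurable.aemeasurable (hmeas.comp (by fun_prop))

lemma conv_moment {σ P : ℝ} (hσ : 0 < σ) {n : ℕ} (μ : Measure (EucSp n)) [IsProbabilityMeasure μ]
    (hi : Integrable (fun x => ‖x‖ ^ 2) μ) (hP : 0 ≤ P) (hμ : ∫ x, ‖x‖ ^ 2 ∂μ ≤ n * P) :
    Integrable (fun x => ‖x‖ ^ 2) (convMeasure μ (gaussMeasure σ n)) ∧
    ∫ x, ‖x‖ ^ 2 ∂(convMeasure μ (gaussMeasure σ n)) ≤ 9 / 4 * (n * (σ ^ 2 + P)) := by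
  have : Fact (0 < σ) := ⟨hσ⟩
  obtain ⟨hg, hg2⟩ := gm_moment hσ n
  have hadd : Measurable fun p : EucSp n × EucSp n => p.1 + p.2 := by fun_prop
  have hi1 : Integrable (fun p : EucSp n × EucSp n => ‖p.1‖ ^ 2) (μ.prod (gaussMeasure σ n)) :=
    hi.comp_fst _
  have hi2 : Integrable (fun p : EucSp n × EucSp n => ‖p.2‖ ^ 2) (μ.prod (gaussMeasure σ n)) :=
    hg.comp_snd _
  have hb : Integrable (fun p : EucSp n × EucSp n => 2 * ‖p.1‖ ^ 2 + 2 * ‖p.2‖ ^ 2)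
      (μ.prod (gaussMeasure σ n)) := (hi1.const_mul 2).add (hi2.const_mul 2)
  have hpt : ∀ p : EucSp n × EucSp n, ‖p.1 + p.2‖ ^ 2 ≤ 2 * ‖p.1‖ ^ 2 + 2 * ‖p.2‖ ^ 2 := by
    intro p
    have := norm_add_le p.1 p.2
    have := norm_nonneg (p.1 + p.2)
    nlinarith [sq_nonneg (‖p.1‖ - ‖p.2‖)]
  have hint : Integrable (fun p : EucSp n × EucSp n => ‖p.1 + p.2‖ ^ 2)
      (μ.prod (gaussMeasure σ n)) := by
    refine hb.mono' (Continuous.aestronglyMeasurable (by fun_prop)) ?_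
    refine Filter.Eventually.of_forall fun p => ?_
    rw [Real.norm_of_nonneg (by positivity)]; exact hpt p
  unfold convMeasure
  constructor
  · rw [integrable_map_measure (Continuous.aestronglyMeasurable (by fun_prop)) hadd.aemeasurable]
    exact hint
  · rw [integral_map hadd.aemeasurable (Continuous.aestronglyMeasurable (by fun_prop))]
    refine (integral_mono hint hb hpt).trans ?_
    rw [integral_add (hi1.const_mul 2) (hi2.const_mul 2), integral_const_mul, integral_const_mul,
      integral_fun_fst (fun x : EucSp n => ‖x‖ ^ 2), integral_fun_snd (fun x : EucSp n => ‖x‖ ^ 2)]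
    simp
    have : 0 ≤ n * P := by positivity
    nlinarith

lemma cs {α : Type*} [MeasurableSpace α] (μ : Measure α) (f g : α → ℝ)
    (hf : ∀ x, 0 ≤ f x) (hg : ∀ x, 0 ≤ g x) (hf2 : MemLp f 2 μ) (hg2 : MemLp g 2 μ) :
    ∫ x, f x * g x ∂μ ≤ Real.sqrt (∫ x, f x ^ 2 ∂μ) * Real.sqrt (∫ x, g x ^ 2 ∂μ) := by
  have := integral_mul_le_Lp_mul_Lq_of_nonneg (μ := μ) (p := 2) (q := 2) (f := f) (g := g)
    Real.HolderConjugate.two_two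
    (Filter.Eventually.of_forall hf) (Filter.Eventually.of_forall hg)
    (by simpa using hf2) (by simpa using hg2)
  simpa [Real.sqrt_eq_rpow] using this

lemma logp_int {σ : ℝ} (hσ : 0 < σ) {n : ℕ} (μ ν : Measure (EucSp n)) [IsProbabilityMeasure μ]
    [IsProbabilityMeasure ν] (hμ : Integrable (fun x => ‖x‖) μ)
    (hν : Integrable (fun x => ‖x‖ ^ 2) ν) :
    Integrable (fun v => Real.log (pdens σ n μ v)) ν := by
  set c := Real.log ((2 * Real.pi * σ ^ 2) ^ (-(n : ℝ) / 2)) with hc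
  set a := Real.log (pdens σ n μ 0) with ha
  set m := ∫ x, ‖x‖ ∂μ with hm
  have hm0 : 0 ≤ m := integral_nonneg fun x => norm_nonneg _
  have hdom : Integrable (fun v : EucSp n => |c| + |a| + (‖v‖ ^ 2 / (2 * σ ^ 2) +
      (1 + ‖v‖ ^ 2) / σ ^ 2 * m)) ν :=
    (integrable_const _).add ((hν.div_const _).add
      ((((integrable_const (1 : ℝ)).add hν).div_const _).mul_const _))
  refine hdom.mono' ((pdens_meas μ).log.aestronglyMeasurable) ?_
  refine Filter.Eventually.of_forall fun v => ?_
  have h1 : Real.log (pdens σ n μ v) ≤ c := Real.log_le_log (pdens_pos hσ μ v) (pdens_le hσ μ v)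
  have h2 := key hσ μ hμ v 0
  simp only [sub_zero, norm_zero, zero_add, ← hm, ← ha] at h2
  have h3 : ‖v‖ / σ ^ 2 * m ≤ (1 + ‖v‖ ^ 2) / σ ^ 2 * m := by
    gcongr
    nlinarith [sq_nonneg (‖v‖ - 1), norm_nonneg v]
  have h4 : 0 ≤ ‖v‖ ^ 2 / (2 * σ ^ 2) := by positivity
  have h5 : 0 ≤ (1 + ‖v‖ ^ 2) / σ ^ 2 * m := by positivity
  rw [Real.norm_eq_abs, abs_le]
  constructor
  · linarith [neg_abs_le a, abs_nonneg c]
  · linarith [le_abs_self c, abs_nonneg a]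

lemma conv_prob {σ : ℝ} (hσ : 0 < σ) {n : ℕ} (μ : Measure (EucSp n)) [IsProbabilityMeasure μ] :
    IsProbabilityMeasure (convMeasure μ (gaussMeasure σ n)) := by
  have : Fact (0 < σ) := ⟨hσ⟩
  unfold convMeasure
  exact Measure.isProbabilityMeasure_map (by fun_prop)

lemma pdens_vint {σ : ℝ} (hσ : 0 < σ) {n : ℕ} (μ : Measure (EucSp n)) [IsProbabilityMeasure μ] :
    Integrable (pdens σ n μ) ∧ ∫ v, pdens σ n μ v = 1 := by
  have h := (conv_prob hσ μ).measure_univ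
  rw [conv_eq hσ μ, withDensity_apply _ MeasurableSet.univ, Measure.restrict_univ] at h
  have hnn : 0 ≤ᵐ[volume] pdens σ n μ := Filter.Eventually.of_forall fun v => (pdens_pos hσ μ v).le
  have hi : Integrable (pdens σ n μ) := by
    refine ⟨(pdens_meas μ).aestronglyMeasurable, ?_⟩
    rw [hasFiniteIntegral_iff_ofReal hnn, h]; simp
  refine ⟨hi, ?_⟩
  rw [integral_eq_lintegral_of_nonneg_ae hnn hi.1, h]; simp

lemma gibbs {σ : ℝ} (hσ : 0 < σ) {n : ℕ} (μ ν : Measure (EucSp n)) [IsProbabilityMeasure μ]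
    [IsProbabilityMeasure ν]
    (h1 : Integrable (fun v => Real.log (pdens σ n μ v)) (convMeasure μ (gaussMeasure σ n)))
    (h2 : Integrable (fun v => Real.log (pdens σ n ν v)) (convMeasure μ (gaussMeasure σ n))) :
    ∫ v, Real.log (pdens σ n ν v) ∂(convMeasure μ (gaussMeasure σ n)) ≤
      ∫ v, Real.log (pdens σ n μ v) ∂(convMeasure μ (gaussMeasure σ n)) := by
  have hprob := conv_prob hσ μ
  have hmeas : Measurable fun v => ENNReal.ofReal (pdens σ n μ v) := (pdens_meas μ).ennreal_ofReal
  have hq : ∀ v, pdens σ n ν v = pdens σ n ν v / pdens σ n μ v * pdens σ n μ v := fun v => by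
    rw [div_mul_cancel₀ _ (pdens_pos hσ μ v).ne']
  have hri : Integrable (fun v => pdens σ n ν v / pdens σ n μ v)
      (convMeasure μ (gaussMeasure σ n)) := by
    rw [conv_eq hσ μ, integrable_withDensity_iff hmeas (by simp)]
    refine (pdens_vint hσ ν).1.congr (Filter.Eventually.of_forall fun v => ?_)
    simp only [ENNReal.toReal_ofReal (pdens_pos hσ μ v).le]; exact hq v
  have hr1 : ∫ v, pdens σ n ν v / pdens σ n μ v ∂(convMeasure μ (gaussMeasure σ n)) = 1 := by
    rw [conv_eq hσ μ, integral_withDensity_eq_integral_toReal_smul hmeas (by simp),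
      ← (pdens_vint hσ ν).2]
    congr 1; ext v
    rw [ENNReal.toReal_ofReal (pdens_pos hσ μ v).le, smul_eq_mul, mul_comm]; exact (hq v).symm
  have hle := integral_mono (h2.sub h1) (hri.sub (integrable_const 1)) (fun v => by
    have := Real.log_le_sub_one_of_pos (div_pos (pdens_pos hσ ν v) (pdens_pos hσ μ v))
    rw [Real.log_div (pdens_pos hσ ν v).ne' (pdens_pos hσ μ v).ne'] at this
    exact this)
  simp only [Pi.sub_apply] at hle
  rw [integral_sub h2 h1, integral_sub hri (integrable_const 1), hr1] at hle
  simp at hle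
  linarith

lemma memLp_two_norm {α : Type*} [MeasurableSpace α] {n : ℕ} {γ : Measure α} {f : α → EucSp n}
    (hf : Measurable f) (h : Integrable (fun x => ‖f x‖ ^ 2) γ) : MemLp (fun x => ‖f x‖) 2 γ :=
  (memLp_two_iff_integrable_sq hf.norm.aestronglyMeasurable).2 h

lemma norm_mean {P : ℝ} {n : ℕ} (μ : Measure (EucSp n)) [IsProbabilityMeasure μ]
    (hi : Integrable (fun x => ‖x‖ ^ 2) μ) (hμ : ∫ x, ‖x‖ ^ 2 ∂μ ≤ n * P) :
    Integrable (fun x => ‖x‖) μ ∧ ∫ x, ‖x‖ ∂μ ≤ Real.sqrt (n * P) := by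
  have hm : MemLp (fun x : EucSp n => ‖x‖) 2 μ := memLp_two_norm measurable_id hi
  refine ⟨hm.integrable (by norm_num), ?_⟩
  have h := cs μ (fun x : EucSp n => ‖x‖) (fun _ => 1) (fun _ => norm_nonneg _)
    (fun _ => zero_le_one) hm (memLp_const 1)
  simp at h
  exact h.trans (Real.sqrt_le_sqrt hμ)

lemma one_side {n : ℕ} {σ P : ℝ} (hσ : 0 < σ) (hP : 0 ≤ P)
    (μ ν : Measure (EucSp n)) [IsProbabilityMeasure μ] [IsProbabilityMeasure ν]
    (hX2 : Integrable (fun x => ‖x‖ ^ 2) μ) (hX'2 : Integrable (fun x => ‖x‖ ^ 2) ν)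
    (hXP : ∫ x, ‖x‖ ^ 2 ∂μ ≤ n * P) (hX'P : ∫ x, ‖x‖ ^ 2 ∂ν ≤ n * P)
    (γ : Measure (EucSp n × EucSp n)) [IsProbabilityMeasure γ]
    (h1 : γ.map Prod.fst = convMeasure μ (gaussMeasure σ n))
    (h2 : γ.map Prod.snd = convMeasure ν (gaussMeasure σ n)) :
    ∫ v, Real.log (pdens σ n ν v) ∂(convMeasure ν (gaussMeasure σ n)) -
      ∫ v, Real.log (pdens σ n μ v) ∂(convMeasure μ (gaussMeasure σ n)) ≤
      1 / σ ^ 2 * (3 * Real.sqrt (n * (σ ^ 2 + P)) + 4 * Real.sqrt (n * P)) *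
        Real.sqrt (∫ z, ‖z.1 - z.2‖ ^ 2 ∂γ) := by
  have hp1 := conv_prob hσ μ
  have hp2 := conv_prob hσ ν
  obtain ⟨hc1, hb1⟩ := conv_moment hσ μ hX2 hP hXP
  obtain ⟨hc2, hb2⟩ := conv_moment hσ ν hX'2 hP hX'P
  obtain ⟨hi1, -⟩ := norm_mean μ hX2 hXP
  obtain ⟨hi2, hm⟩ := norm_mean ν hX'2 hX'P
  have hg := gibbs hσ μ ν (logp_int hσ μ _ hi1 hc1) (logp_int hσ ν _ hi2 hc1)
  have l1 := logp_int hσ ν _ hi2 hc1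
  have l2 := logp_int hσ ν _ hi2 hc2
  have hlm : ∀ ρ : Measure (EucSp n), AEStronglyMeasurable (fun v => Real.log (pdens σ n ν v)) ρ :=
    fun ρ => (pdens_meas ν).log.aestronglyMeasurable
  have hsm : ∀ ρ : Measure (EucSp n), AEStronglyMeasurable (fun v : EucSp n => ‖v‖ ^ 2) ρ :=
    fun ρ => Continuous.aestronglyMeasurable (by fun_prop)
  rw [← h1] at hc1 hb1 l1
  rw [← h2] at hc2 hb2 l2
  have e1 : ∫ v, Real.log (pdens σ n ν v) ∂(convMeasure μ (gaussMeasure σ n)) =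
      ∫ z, Real.log (pdens σ n ν z.1) ∂γ := by
    rw [← h1, integral_map measurable_fst.aemeasurable (hlm _)]
  have e2 : ∫ v, Real.log (pdens σ n ν v) ∂(convMeasure ν (gaussMeasure σ n)) =
      ∫ z, Real.log (pdens σ n ν z.2) ∂γ := by
    rw [← h2, integral_map measurable_snd.aemeasurable (hlm _)]
  rw [integral_map measurable_fst.aemeasurable (hsm _)] at hb1
  rw [integral_map measurable_snd.aemeasurable (hsm _)] at hb2
  rw [integrable_map_measure (hsm _) measurable_fst.aemeasurable] at hc1
  rw [integrable_map_measure (hsm _) measurable_snd.aemeasurable] at hc2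
  rw [integrable_map_measure (hlm _) measurable_fst.aemeasurable] at l1
  rw [integrable_map_measure (hlm _) measurable_snd.aemeasurable] at l2
  simp only [Function.comp_def] at hc1 hc2 l1 l2
  have mU : MemLp (fun z : EucSp n × EucSp n => ‖z.1‖) 2 γ := memLp_two_norm measurable_fst hc1
  have mV : MemLp (fun z : EucSp n × EucSp n => ‖z.2‖) 2 γ := memLp_two_norm measurable_snd hc2
  have hc3 : Integrable (fun z : EucSp n × EucSp n => ‖z.1 - z.2‖ ^ 2) γ := by
    refine ((hc1.const_mul 2).add (hc2.const_mul 2)).mono'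
      (Continuous.aestronglyMeasurable (by fun_prop)) ?_
    refine Filter.Eventually.of_forall fun p => ?_
    rw [Real.norm_of_nonneg (by positivity)]
    simp only [Pi.add_apply]
    have := norm_sub_le p.1 p.2
    have := norm_nonneg (p.1 - p.2)
    nlinarith [sq_nonneg (‖p.1‖ - ‖p.2‖)]
  have mD : MemLp (fun z : EucSp n × EucSp n => ‖z.1 - z.2‖) 2 γ :=
    memLp_two_norm (by fun_prop) hc3
  have iDU : Integrable (fun z : EucSp n × EucSp n => ‖z.1 - z.2‖ * ‖z.1‖) γ := mD.integrable_mul mU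
  have iDV : Integrable (fun z : EucSp n × EucSp n => ‖z.1 - z.2‖ * ‖z.2‖) γ := mD.integrable_mul mV
  have m1 : MemLp (fun _ : EucSp n × EucSp n => (1 : ℝ)) 2 γ := memLp_const 1
  have iD : Integrable (fun z : EucSp n × EucSp n => ‖z.1 - z.2‖ * 1) γ := mD.integrable_mul m1
  have cU := cs γ _ _ (fun z => norm_nonneg (z.1 - z.2)) (fun z => norm_nonneg z.1) mD mU
  have cV := cs γ _ _ (fun z => norm_nonneg (z.1 - z.2)) (fun z => norm_nonneg z.2) mD mV
  have cD := cs γ _ _ (fun z => norm_nonneg (z.1 - z.2)) (fun _ => zero_le_one) mD m1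
  set m := ∫ x, ‖x‖ ∂ν with hmdef
  have hm0 : 0 ≤ m := integral_nonneg fun x => norm_nonneg _
  have hpt : ∀ z : EucSp n × EucSp n, Real.log (pdens σ n ν z.2) - Real.log (pdens σ n ν z.1) ≤
      1 / σ ^ 2 * (1 / 2 * (‖z.1 - z.2‖ * ‖z.1‖) + 3 / 2 * (‖z.1 - z.2‖ * ‖z.2‖) +
        m * (‖z.1 - z.2‖ * 1)) := by
    intro z
    refine (key hσ ν hi2 z.1 z.2).trans ?_
    rw [← hmdef]
    have t1 := norm_sub_le z.1 z.2
    have t2 := mul_le_mul_of_nonneg_left t1 (norm_nonneg (z.1 - z.2))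
    have : ‖z.1 - z.2‖ ^ 2 / (2 * σ ^ 2) + ‖z.1 - z.2‖ / σ ^ 2 * (‖z.2‖ + m) =
      1 / σ ^ 2 * (1 / 2 * (‖z.1 - z.2‖ * ‖z.1 - z.2‖) + (‖z.1 - z.2‖ * ‖z.2‖) +
        m * (‖z.1 - z.2‖ * 1)) := by field_simp; ring
    rw [this]
    apply mul_le_mul_of_nonneg_left _ (by positivity)
    nlinarith
  have iS : Integrable (fun z : EucSp n × EucSp n => 1 / 2 * (‖z.1 - z.2‖ * ‖z.1‖) +
      3 / 2 * (‖z.1 - z.2‖ * ‖z.2‖)) γ := (iDU.const_mul (1 / 2)).add (iDV.const_mul (3 / 2))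
  have hI := integral_mono (l2.sub l1)
    ((((iDU.const_mul (1 / 2)).add (iDV.const_mul (3 / 2))).add (iD.const_mul m)).const_mul
      (1 / σ ^ 2)) hpt
  simp only [Pi.sub_apply, Pi.add_apply] at hI
  rw [integral_sub l2 l1, integral_const_mul,
    integral_add iS (iD.const_mul m),
    integral_add (iDU.const_mul (1 / 2)) (iDV.const_mul (3 / 2)),
    integral_const_mul, integral_const_mul, integral_const_mul] at hI
  set W := Real.sqrt (∫ z, ‖z.1 - z.2‖ ^ 2 ∂γ) with hW
  have hW0 : 0 ≤ W := Real.sqrt_nonneg _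
  set S := Real.sqrt (n * (σ ^ 2 + P)) with hS
  set Q := Real.sqrt (n * P) with hQ
  have hQ0 : 0 ≤ Q := Real.sqrt_nonneg _
  have hsq : Real.sqrt (9 / 4 * (n * (σ ^ 2 + P))) = 3 / 2 * S := by
    rw [Real.sqrt_mul (by norm_num), show (9 / 4 : ℝ) = (3 / 2) ^ 2 by norm_num,
      Real.sqrt_sq (by norm_num)]
  have sU := Real.sqrt_le_sqrt hb1
  have sV := Real.sqrt_le_sqrt hb2
  rw [hsq] at sU sV
  have wU := mul_le_mul_of_nonneg_left sU hW0
  have wV := mul_le_mul_of_nonneg_left sV hW0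
  simp at cD
  simp only [mul_one] at hI
  have wD : m * ∫ z, ‖z.1 - z.2‖ ∂γ ≤ Q * W := by
    calc _ ≤ m * W := mul_le_mul_of_nonneg_left cD hm0
      _ ≤ Q * W := mul_le_mul_of_nonneg_right hm hW0
  rw [e1] at hg
  rw [e2]
  calc _ ≤ _ := by linarith
    _ ≤ _ := hI
    _ ≤ 1 / σ ^ 2 * ((3 * S + 4 * Q) * W) := by
      apply mul_le_mul_of_nonneg_left _ (by positivity)
      have : 0 ≤ Q * W := by positivity
      nlinarith
    _ = _ := by ring

/-- Let `X, X̃ ⟂ Z` with `Z ∼ N(0, σ²Iₙ)` and `E[‖X‖²] ≤ nP`,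
`E[‖X̃‖²] ≤ nP`. Then `|h(X+Z) − h(X̃+Z)| ≤ Δ` with
`Δ = (1/σ²)(3√(n(σ²+P)) + 4√(nP)) · W₂(P_{X+Z}, P_{X̃+Z})`.
Here the law of `X+Z` is the convolution `μX ∗ N(0,σ²Iₙ)`, with density
`v ↦ E[p_Z(v − X)]`, and `h(X+Z) = −E[log p_{X+Z}(X+Z)]`. -/
theorem stmt9 {n : ℕ} {σ P : ℝ} (hσ : 0 < σ) (hP : 0 ≤ P)
    {μX μX' : Measure (EucSp n)} [IsProbabilityMeasure μX] [IsProbabilityMeasure μX']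
    (hX2 : Integrable (fun x => ‖x‖ ^ 2) μX) (hX'2 : Integrable (fun x => ‖x‖ ^ 2) μX')
    (hXP : ∫ x, ‖x‖ ^ 2 ∂μX ≤ n * P) (hX'P : ∫ x, ‖x‖ ^ 2 ∂μX' ≤ n * P) :
    |(- ∫ v, Real.log (∫ x, gaussDensity σ n (v - x) ∂μX) ∂(convMeasure μX (gaussMeasure σ n))) -
      (- ∫ v, Real.log (∫ x, gaussDensity σ n (v - x) ∂μX')
          ∂(convMeasure μX' (gaussMeasure σ n)))| ≤
      1 / σ ^ 2 * (3 * Real.sqrt (n * (σ ^ 2 + P)) + 4 * Real.sqrt (n * P)) *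
        W2 (convMeasure μX (gaussMeasure σ n)) (convMeasure μX' (gaussMeasure σ n)) := by
  change |(- ∫ v, Real.log (pdens σ n μX v) ∂(convMeasure μX (gaussMeasure σ n))) -
      (- ∫ v, Real.log (pdens σ n μX' v) ∂(convMeasure μX' (gaussMeasure σ n)))| ≤ _
  have hp1 := conv_prob hσ μX
  have hp2 := conv_prob hσ μX'
  set C := 1 / σ ^ 2 * (3 * Real.sqrt (n * (σ ^ 2 + P)) + 4 * Real.sqrt (n * P)) with hC
  have hC0 : 0 ≤ C := by rw [hC]; positivity
  set L := |(- ∫ v, Real.log (pdens σ n μX v) ∂(convMeasure μX (gaussMeasure σ n))) -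
      (- ∫ v, Real.log (pdens σ n μX' v) ∂(convMeasure μX' (gaussMeasure σ n)))| with hL
  have main : ∀ γ, IsCoupling (convMeasure μX (gaussMeasure σ n))
      (convMeasure μX' (gaussMeasure σ n)) γ →
      L ≤ C * Real.sqrt (∫ z, ‖z.1 - z.2‖ ^ 2 ∂γ) := by
    rintro γ ⟨hγ, h1, h2⟩
    have a1 := one_side hσ hP μX μX' hX2 hX'2 hXP hX'P γ h1 h2
    have hs : IsProbabilityMeasure (γ.map Prod.swap) :=
      Measure.isProbabilityMeasure_map measurable_swap.aemeasurable
    have a2 := one_side hσ hP μX' μX hX'2 hX2 hX'P hXP (γ.map Prod.swap)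
      (by rw [Measure.map_map measurable_fst measurable_swap]; exact h2)
      (by rw [Measure.map_map measurable_snd measurable_swap]; exact h1)
    rw [integral_map measurable_swap.aemeasurable
      (Continuous.aestronglyMeasurable (by fun_prop))] at a2
    have hsw : ∫ z : EucSp n × EucSp n, ‖z.swap.1 - z.swap.2‖ ^ 2 ∂γ =
        ∫ z, ‖z.1 - z.2‖ ^ 2 ∂γ := by
      congr 1; ext z; rw [Prod.fst_swap, Prod.snd_swap, norm_sub_rev]
    rw [hsw] at a2
    rw [hL, abs_le]
    constructor <;> linarith
  have hprod : IsCoupling (convMeasure μX (gaussMeasure σ n)) (convMeasure μX' (gaussMeasure σ n))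
      ((convMeasure μX (gaussMeasure σ n)).prod (convMeasure μX' (gaussMeasure σ n))) := by
    refine ⟨inferInstance, ?_, ?_⟩
    · simp [Measure.map_fst_prod]
    · simp [Measure.map_snd_prod]
  rcases hC0.eq_or_lt with h0 | h0
  · have := main _ hprod
    rw [← h0] at this ⊢
    simpa using this
  · rw [← div_le_iff₀' h0]
    unfold W2
    refine le_csInf ⟨_, ⟨_, hprod, rfl⟩⟩ ?_
    rintro r ⟨γ, hγ, rfl⟩
    rw [div_le_iff₀' h0]
    exact main γ hγ
end
end

section
/- Let 𝒳 be a finite alphabet and n ≥ 1, and let P and Q be probability distributions on 𝒳ⁿ. Then |H(P) − H(Q)| ≤ n · F_𝒳( d̄(P,Q) ), where F_𝒳(x) = x·log(|𝒳| − 1) + x·log(1/x) + (1−x)·log(1/(1−x)) for 0 ≤ x ≤ 1 (with the convention 0·log(1/0) = 0). -/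
open scoped BigOperators

noncomputable section

/-- `p` is a probability distribution on the finite set `α`. -/
def IsDist {α : Type*} [Fintype α] (p : α → ℝ) : Prop :=
  (∀ a, 0 ≤ p a) ∧ ∑ a, p a = 1

/-- Shannon entropy `H(p) = −∑ p log p` (natural logarithm). -/
def Hent {α : Type*} [Fintype α] (p : α → ℝ) : ℝ :=
  ∑ a, Real.negMulLog (p a)

/-- Ornstein's `d̄`-distance between distributions on `αⁿ`: `(1/n)` times the minimal expected
Hamming distance over all couplings. -/
def dbar {α : Type*} [Fintype α] [DecidableEq α] (n : ℕ) (p q : (Fin n → α) → ℝ) : ℝ :=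
  sInf { r | ∃ γ : (Fin n → α) × (Fin n → α) → ℝ,
    (∀ z, 0 ≤ γ z) ∧ (∀ x, ∑ y, γ (x, y) = p x) ∧ (∀ y, ∑ x, γ (x, y) = q y) ∧
    r = (1 / (n : ℝ)) * ∑ z : (Fin n → α) × (Fin n → α), γ z * (hammingDist z.1 z.2 : ℝ) }

open Real Filter Topology in
lemma gibbs_aux {A : Type*} [Fintype A] (p q : A → ℝ) (hp : IsDist p) (hq : IsDist q)
    (γ W : A → A → ℝ) (h0 : ∀ x y, 0 ≤ γ x y) (h1 : ∀ x, ∑ y, γ x y = p x)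
    (h2 : ∀ y, ∑ x, γ x y = q y) (hW : ∀ x y, 0 < W x y) (hW1 : ∀ y, ∑ x, W x y = 1) :
    Hent p - Hent q ≤ ∑ x, ∑ y, γ x y * (-Real.log (W x y)) := by
  have key : ∀ x y, γ x y * (-Real.log (p x) + Real.log (q y) + Real.log (W x y))
      ≤ q y * W x y - γ x y := by
    intro x y
    rcases (h0 x y).eq_or_lt with h | h
    · rw [← h]
      have := mul_nonneg (hq.1 y) (hW x y).le
      linarith
    · have hpx : γ x y ≤ p x := by
        rw [← h1 x]
        exact Finset.single_le_sum (f := fun y => γ x y) (fun i _ => h0 x i) (Finset.mem_univ y)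
      have hqy : γ x y ≤ q y := by
        rw [← h2 y]
        exact Finset.single_le_sum (f := fun x => γ x y) (fun i _ => h0 i y) (Finset.mem_univ x)
      have hp0 : 0 < p x := by linarith
      have hq0 : 0 < q y := by linarith
      have hw0 := hW x y
      have hlog := Real.log_le_sub_one_of_pos (x := q y * W x y / p x) (by positivity)
      rw [Real.log_div (by positivity) (by positivity),
        Real.log_mul (by positivity) (by positivity)] at hlog
      have e1 := mul_le_mul_of_nonneg_left hlog h.le
      have e2 : γ x y * (q y * W x y / p x) ≤ q y * W x y := by
        rw [mul_div_assoc', div_le_iff₀ hp0, mul_comm]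
        exact mul_le_mul_of_nonneg_left hpx (by positivity)
      nlinarith
  have hsum := Finset.sum_le_sum (s := Finset.univ) fun x _ =>
    Finset.sum_le_sum (s := Finset.univ) fun y _ => key x y
  have eL : ∑ x, ∑ y, γ x y * (-Real.log (p x) + Real.log (q y) + Real.log (W x y))
      = Hent p - Hent q - ∑ x, ∑ y, γ x y * (-Real.log (W x y)) := by
    have a1 : Hent p = ∑ x, ∑ y, γ x y * (-Real.log (p x)) := by
      unfold Hent
      refine Finset.sum_congr rfl fun x _ => ?_
      rw [← Finset.sum_mul, h1, Real.negMulLog]; ring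
    have a2 : Hent q = ∑ x, ∑ y, γ x y * (-Real.log (q y)) := by
      unfold Hent
      rw [Finset.sum_comm]
      refine Finset.sum_congr rfl fun x _ => ?_
      rw [← Finset.sum_mul, h2, Real.negMulLog]; ring
    rw [a1, a2]
    simp only [← Finset.sum_sub_distrib]
    refine Finset.sum_congr rfl fun x _ => Finset.sum_congr rfl fun y _ => by ring
  have eR : ∑ x, ∑ y, (q y * W x y - γ x y) = 0 := by
    simp only [Finset.sum_sub_distrib]
    rw [Finset.sum_comm]
    simp only [← Finset.mul_sum, hW1, h1, mul_one, hq.2, hp.2, sub_self]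
  rw [eL, eR] at hsum
  linarith

lemma chan_sum {𝒳 : Type*} [Fintype 𝒳] [DecidableEq 𝒳] (hk : 2 ≤ Fintype.card 𝒳) {n : ℕ}
    (δ : ℝ) (y : Fin n → 𝒳) :
    ∑ x : Fin n → 𝒳, ∏ i, (if x i = y i then 1 - δ else δ / ((Fintype.card 𝒳 : ℝ) - 1)) = 1 := by
  have hk' : (2 : ℝ) ≤ Fintype.card 𝒳 := by exact_mod_cast hk
  have h := (Finset.prod_univ_sum (fun _ : Fin n => (Finset.univ : Finset 𝒳))
    (fun i a => if a = y i then 1 - δ else δ / ((Fintype.card 𝒳 : ℝ) - 1))).symm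
  rw [Fintype.piFinset_univ] at h
  rw [h]
  refine Finset.prod_eq_one fun i _ => ?_
  have : ∀ a : 𝒳, (if a = y i then 1 - δ else δ / ((Fintype.card 𝒳 : ℝ) - 1))
      = δ / ((Fintype.card 𝒳 : ℝ) - 1) +
        (if a = y i then 1 - δ - δ / ((Fintype.card 𝒳 : ℝ) - 1) else 0) := by
    intro a; split_ifs <;> ring
  simp only [this, Finset.sum_add_distrib, Finset.sum_ite_eq', Finset.mem_univ, if_true,
    Finset.sum_const, Finset.card_univ, nsmul_eq_mul]
  have : (Fintype.card 𝒳 : ℝ) - 1 ≠ 0 := by linarith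
  field_simp
  ring

lemma chan_log {𝒳 : Type*} [DecidableEq 𝒳] {n : ℕ} (a b : ℝ) (ha : 0 < a) (hb : 0 < b)
    (x y : Fin n → 𝒳) :
    Real.log (∏ i, (if x i = y i then a else b)) =
      n * Real.log a + (hammingDist x y : ℝ) * (Real.log b - Real.log a) := by
  rw [Real.log_prod (fun i _ => by split_ifs <;> positivity)]
  have : ∀ i, Real.log (if x i = y i then a else b)
      = Real.log a + (if x i ≠ y i then Real.log b - Real.log a else 0) := by
    intro i; by_cases h : x i = y i <;> simp [h]
  simp only [this, Finset.sum_add_distrib, ← Finset.sum_filter, Finset.sum_const, nsmul_eq_mul,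
    Finset.card_univ, Fintype.card_fin]
  rfl

lemma coupling_bound {𝒳 : Type*} [Fintype 𝒳] [DecidableEq 𝒳] (hk : 2 ≤ Fintype.card 𝒳)
    {n : ℕ} (hn : 1 ≤ n)
    (p q : (Fin n → 𝒳) → ℝ) (hp : IsDist p) (hq : IsDist q)
    (γ : (Fin n → 𝒳) → (Fin n → 𝒳) → ℝ) (h0 : ∀ x y, 0 ≤ γ x y) (h1 : ∀ x, ∑ y, γ x y = p x)
    (h2 : ∀ y, ∑ x, γ x y = q y) (r : ℝ) (hr0 : 0 ≤ r) (hr1 : r ≤ 1)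
    (hr : n * r = ∑ x, ∑ y, γ x y * (hammingDist x y : ℝ)) :
    Hent p - Hent q ≤ n * (r * Real.log ((Fintype.card 𝒳 : ℝ) - 1) +
        Real.negMulLog r + Real.negMulLog (1 - r)) := by
  have hk' : (2 : ℝ) ≤ Fintype.card 𝒳 := by exact_mod_cast hk
  have hk1 : (0 : ℝ) < (Fintype.card 𝒳 : ℝ) - 1 := by linarith
  have hδ : ∀ δ ∈ Set.Ioo (0 : ℝ) 1, Hent p - Hent q ≤
      n * (r * Real.log ((Fintype.card 𝒳 : ℝ) - 1) + (-(r * Real.log δ))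
        + (-((1 - r) * Real.log (1 - δ)))) := by
    intro δ hd
    have d0 := hd.1
    have d1 : 0 < 1 - δ := by linarith [hd.2]
    have hb : 0 < δ / ((Fintype.card 𝒳 : ℝ) - 1) := by positivity
    have := gibbs_aux p q hp hq γ (fun x y => ∏ i, (if x i = y i then 1 - δ
      else δ / ((Fintype.card 𝒳 : ℝ) - 1))) h0 h1 h2
      (fun x y => Finset.prod_pos fun i _ => by split_ifs <;> positivity)
      (fun y => chan_sum hk δ y)
    refine this.trans (le_of_eq ?_)
    simp only [chan_log _ _ d1 hb]
    rw [Real.log_div d0.ne' hk1.ne']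
    set L := Real.log ((Fintype.card 𝒳 : ℝ) - 1)
    have : ∀ x y, γ x y * -(n * Real.log (1 - δ) +
        (hammingDist x y : ℝ) * (Real.log δ - L - Real.log (1 - δ)))
        = γ x y * (-(n * Real.log (1 - δ))) +
          (γ x y * (hammingDist x y : ℝ)) * (-(Real.log δ - L - Real.log (1 - δ))) := by
      intro x y; ring
    simp only [this, Finset.sum_add_distrib, ← Finset.sum_mul]
    rw [← hr]
    simp only [h1, hp.2]
    ring
  have hmem : r ∈ closure (Set.Ioo (0 : ℝ) 1) := by
    rw [closure_Ioo (by norm_num)]; exact ⟨hr0, hr1⟩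
  have hne : (nhdsWithin r (Set.Ioo (0 : ℝ) 1)).NeBot := mem_closure_iff_nhdsWithin_neBot.1 hmem
  have c1 : ContinuousAt (fun δ : ℝ => r * Real.log δ) r := by
    rcases eq_or_ne r 0 with h | h
    · subst h; simp only [zero_mul]; exact continuousAt_const
    · exact continuousAt_const.mul (Real.continuousAt_log h)
  have c2 : ContinuousAt (fun δ : ℝ => (1 - r) * Real.log (1 - δ)) r := by
    rcases eq_or_ne (1 - r) 0 with h | h
    · rw [h]; simp only [zero_mul]; exact continuousAt_const
    · exact continuousAt_const.mul
        (ContinuousAt.log (continuousAt_const.sub continuousAt_id) h)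
  have c : ContinuousAt (fun δ : ℝ => n * (r * Real.log ((Fintype.card 𝒳 : ℝ) - 1)
      + (-(r * Real.log δ)) + (-((1 - r) * Real.log (1 - δ))))) r :=
    continuousAt_const.mul ((continuousAt_const.add c1.neg).add c2.neg)
  have t := ge_of_tendsto (c.tendsto.mono_left nhdsWithin_le_nhds)
    (Filter.eventually_of_mem self_mem_nhdsWithin hδ)
  refine t.trans (le_of_eq ?_)
  simp only [Real.negMulLog]; ring

/-- For distributions `P, Q` on `𝒳ⁿ`,
`|H(P) − H(Q)| ≤ n F_𝒳(d̄(P,Q))` where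
`F_𝒳(x) = x log(|𝒳|−1) + x log(1/x) + (1−x) log(1/(1−x))`
(the last two terms are written with `Real.negMulLog`, which encodes the convention
`0 · log(1/0) = 0`). -/
theorem stmt13 {𝒳 : Type*} [Fintype 𝒳] [DecidableEq 𝒳] [Nonempty 𝒳] {n : ℕ} (hn : 1 ≤ n)
    (p q : (Fin n → 𝒳) → ℝ) (hp : IsDist p) (hq : IsDist q) :
    |Hent p - Hent q| ≤
      n * (dbar n p q * Real.log ((Fintype.card 𝒳 : ℝ) - 1) +
        Real.negMulLog (dbar n p q) + Real.negMulLog (1 - dbar n p q)) := by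
  have hn0 : (0 : ℝ) < n := by exact_mod_cast hn
  set F : ℝ → ℝ := fun r => n * (r * Real.log ((Fintype.card 𝒳 : ℝ) - 1) +
        Real.negMulLog r + Real.negMulLog (1 - r)) with hF
  have hFc : Continuous F := by
    have h1 := Real.continuous_negMulLog
    have h2 : Continuous fun r : ℝ => Real.negMulLog (1 - r) :=
      h1.comp (continuous_const.sub continuous_id)
    exact continuous_const.mul (((continuous_id.mul continuous_const).add h1).add h2)
  change _ ≤ F (dbar n p q)
  unfold dbar
  set S := { r | ∃ γ : (Fin n → 𝒳) × (Fin n → 𝒳) → ℝ,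
    (∀ z, 0 ≤ γ z) ∧ (∀ x, ∑ y, γ (x, y) = p x) ∧ (∀ y, ∑ x, γ (x, y) = q y) ∧
    r = (1 / (n : ℝ)) * ∑ z : (Fin n → 𝒳) × (Fin n → 𝒳), γ z * (hammingDist z.1 z.2 : ℝ) }
    with hS
  have hne : S.Nonempty := by
    refine ⟨_, fun z => p z.1 * q z.2, fun z => mul_nonneg (hp.1 _) (hq.1 _), ?_, ?_, rfl⟩
    · intro x; simp only [← Finset.mul_sum, hq.2, mul_one]
    · intro y; simp only [← Finset.sum_mul, hp.2, one_mul]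
  have hnn : ∀ r ∈ S, 0 ≤ r := by
    rintro r ⟨γ, h0, -, -, rfl⟩
    exact mul_nonneg (by positivity)
      (Finset.sum_nonneg fun z _ => mul_nonneg (h0 z) (Nat.cast_nonneg _))
  have hmem : sInf S ∈ closure S := csInf_mem_closure hne ⟨0, hnn⟩
  have hsub : S ⊆ {r | |Hent p - Hent q| ≤ F r} := by
    intro r hrS
    have hr0 := hnn r hrS
    obtain ⟨γ, h0, h1, h2, hr⟩ := hrS
    have hr' : n * r = ∑ x, ∑ y, γ (x, y) * (hammingDist x y : ℝ) := by
      rw [hr, Fintype.sum_prod_type]; field_simp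
    have hr1 : r ≤ 1 := by
      have : n * r ≤ n * 1 := by
        rw [hr']
        calc ∑ x, ∑ y, γ (x, y) * (hammingDist x y : ℝ)
            ≤ ∑ x, ∑ y, γ (x, y) * (n : ℝ) := by
              refine Finset.sum_le_sum fun x _ => Finset.sum_le_sum fun y _ =>
                mul_le_mul_of_nonneg_left ?_ (h0 _)
              have := hammingDist_le_card_fintype (x := x) (y := y)
              rw [Fintype.card_fin] at this
              exact_mod_cast this
          _ = n * 1 := by simp only [← Finset.sum_mul, h1, hp.2]; ring
      exact le_of_mul_le_mul_left this hn0
    change _ ≤ F r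
    by_cases hk : 2 ≤ Fintype.card 𝒳
    · rw [abs_le']
      refine ⟨coupling_bound hk hn p q hp hq (fun x y => γ (x, y)) (fun x y => h0 _) h1 h2 r
        hr0 hr1 hr', ?_⟩
      rw [neg_sub]
      refine coupling_bound hk hn q p hq hp (fun x y => γ (y, x)) (fun x y => h0 _) h2 h1 r
        hr0 hr1 ?_
      rw [hr', Finset.sum_comm]
      simp only [hammingDist_comm]
    · have hc : Fintype.card 𝒳 = 1 := by
        have := Fintype.card_pos (α := 𝒳)
        omega
      have : Subsingleton 𝒳 := Fintype.card_le_one_iff_subsingleton.1 hc.le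
      have hpq : p = q := by
        funext x
        have e1 := hp.2
        have e2 := hq.2
        rw [Fintype.sum_subsingleton _ x] at e1 e2
        rw [e1, e2]
      rw [hpq, sub_self, abs_zero]
      have := Real.binEntropy_nonneg hr0 hr1
      rw [Real.binEntropy_eq_negMulLog_add_negMulLog_one_sub] at this
      simp only [hF, hc, Nat.cast_one, sub_self, Real.log_zero, mul_zero, zero_add]
      positivity
  exact closure_minimal hsub (isClosed_le continuous_const hFc) hmem
end
end

section
/- Let 𝒳, 𝒜, 𝒴 be finite alphabets and W(·|·,·) a strictly positive stochastic matrix from 𝒳×𝒜 to 𝒴. Let X, A, Ã be independent random vectors taking values in 𝒳ⁿ, 𝒜ⁿ, 𝒜ⁿ respectively, and let Y and Ỹ be outputs of the blocklength-n memoryless channel P_{Y|X,A}(y|x,a) = ∏_{j=1}^n W(y_j|x_j,a_j) with inputs (X,A) and (X,Ã) respectively. Then |H(Y) − H(Ỹ)| ≤ c·n·d̄(P_Y, P_Ỹ), where c = max over x ∈ 𝒳, a ∈ 𝒜, y, y' ∈ 𝒴 of log( W(y|x,a) / W(y'|x,a) ). -/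
open scoped BigOperators

noncomputable section

/-- The output distribution of the blocklength-`n` memoryless two-input channel `W` when the
independent inputs have distributions `pX` and `pA`. -/
def outDist {𝒳 𝒜 𝒴 : Type*} [Fintype 𝒳] [Fintype 𝒜] [Fintype 𝒴] {n : ℕ}
    (W : 𝒳 → 𝒜 → 𝒴 → ℝ) (pX : (Fin n → 𝒳) → ℝ) (pA : (Fin n → 𝒜) → ℝ) :
    (Fin n → 𝒴) → ℝ :=
  fun y => ∑ x : Fin n → 𝒳, ∑ a : Fin n → 𝒜, pX x * pA a * ∏ j, W (x j) (a j) (y j)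

/-- The conditional output distribution given the first input `x`, when the second (independent)
input has distribution `pA`. -/
def condOut {𝒳 𝒜 𝒴 : Type*} [Fintype 𝒜] [Fintype 𝒴] {n : ℕ}
    (W : 𝒳 → 𝒜 → 𝒴 → ℝ) (pA : (Fin n → 𝒜) → ℝ) (x : Fin n → 𝒳) :
    (Fin n → 𝒴) → ℝ :=
  fun y => ∑ a : Fin n → 𝒜, pA a * ∏ j, W (x j) (a j) (y j)


lemma aux_gibbs {α : Type*} [Fintype α] (p q : α → ℝ) (hp : ∀ a, 0 < p a) (hq : ∀ a, 0 < q a)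
    (hps : ∑ a, p a = 1) (hqs : ∑ a, q a = 1) :
    ∑ a, q a * Real.log (p a) ≤ ∑ a, q a * Real.log (q a) := by
  have h : ∑ a, (q a * Real.log (p a) - q a * Real.log (q a)) ≤ ∑ a, (p a - q a) := by
    refine Finset.sum_le_sum fun a _ => ?_
    have h1 := Real.log_le_sub_one_of_pos (div_pos (hp a) (hq a))
    rw [Real.log_div (hp a).ne' (hq a).ne'] at h1
    have h2 := mul_le_mul_of_nonneg_left h1 (hq a).le
    have h3 : q a * (p a / q a - 1) = p a - q a := by
      have := (hq a).ne'
      field_simp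
    linarith
  rw [Finset.sum_sub_distrib, Finset.sum_sub_distrib, hps, hqs] at h
  linarith

lemma aux_one_side {β : Type*} [Fintype β] (d : β → β → ℝ) (c : ℝ) (p q : β → ℝ)
    (hp : ∀ a, 0 < p a) (hq : ∀ a, 0 < q a)
    (hps : ∑ a, p a = 1) (hqs : ∑ a, q a = 1)
    (hL : ∀ y y', Real.log (p y) - Real.log (p y') ≤ c * d y y')
    (g : β → β → ℝ) (hg : ∀ y y', 0 ≤ g y y')
    (h1 : ∀ x, ∑ y, g x y = p x) (h2 : ∀ y, ∑ x, g x y = q y) :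
    Hent q - Hent p ≤ c * ∑ x, ∑ y, g x y * d x y := by
  have hG := aux_gibbs p q hp hq hps hqs
  have e1 : Hent q = - ∑ a, q a * Real.log (q a) := by
    simp [Hent, Real.negMulLog, Finset.sum_neg_distrib]
  have e2 : Hent p = - ∑ a, p a * Real.log (p a) := by
    simp [Hent, Real.negMulLog, Finset.sum_neg_distrib]
  have e3 : ∑ a, p a * Real.log (p a) = ∑ x, ∑ y, g x y * Real.log (p x) := by
    refine Finset.sum_congr rfl fun x _ => ?_
    rw [← Finset.sum_mul, h1]
  have e4 : ∑ a, q a * Real.log (p a) = ∑ x, ∑ y, g x y * Real.log (p y) := by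
    rw [Finset.sum_comm]
    refine Finset.sum_congr rfl fun x _ => ?_
    rw [← Finset.sum_mul, h2]
  have e5 : ∑ x, ∑ y, g x y * Real.log (p x) - ∑ x, ∑ y, g x y * Real.log (p y)
      ≤ c * ∑ x, ∑ y, g x y * d x y := by
    rw [← Finset.sum_sub_distrib, Finset.mul_sum]
    refine Finset.sum_le_sum fun x _ => ?_
    rw [← Finset.sum_sub_distrib, Finset.mul_sum]
    refine Finset.sum_le_sum fun y _ => ?_
    have := mul_le_mul_of_nonneg_left (hL x y) (hg x y)
    linarith
  linarith

lemma aux_lip {𝒳 𝒜 𝒴 : Type*} [Fintype 𝒳] [Fintype 𝒜] [Fintype 𝒴] [DecidableEq 𝒴]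
    (W : 𝒳 → 𝒜 → 𝒴 → ℝ) (hW : ∀ x a y, 0 < W x a y) (c : ℝ)
    (hc : ∀ x a y y', Real.log (W x a y / W x a y') ≤ c)
    {n : ℕ} (pX : (Fin n → 𝒳) → ℝ) (pA : (Fin n → 𝒜) → ℝ)
    (hpX : ∀ x, 0 ≤ pX x) (hpA : ∀ x, 0 ≤ pA x) (y y' : Fin n → 𝒴) :
    outDist W pX pA y ≤ Real.exp (c * hammingDist y y') * outDist W pX pA y' := by
  unfold outDist
  rw [Finset.mul_sum]
  refine Finset.sum_le_sum fun x _ => ?_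
  rw [Finset.mul_sum]
  refine Finset.sum_le_sum fun a _ => ?_
  have key : ∏ j, W (x j) (a j) (y j)
      ≤ Real.exp (c * hammingDist y y') * ∏ j, W (x j) (a j) (y' j) := by
    have e : Real.exp (c * hammingDist y y') = ∏ j, (if y j ≠ y' j then Real.exp c else 1) := by
      rw [Finset.prod_ite, Finset.prod_const, Finset.prod_const_one, mul_one, mul_comm,
        Real.exp_nat_mul]
      rfl
    rw [e, ← Finset.prod_mul_distrib]
    refine Finset.prod_le_prod (fun j _ => (hW _ _ _).le) fun j _ => ?_
    split_ifs with h
    · have h1 := hc (x j) (a j) (y j) (y' j)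
      rw [Real.log_le_iff_le_exp (div_pos (hW _ _ _) (hW _ _ _)), div_le_iff₀ (hW _ _ _)] at h1
      exact h1
    · push Not at h
      rw [h, one_mul]
  have := mul_le_mul_of_nonneg_left key (mul_nonneg (hpX x) (hpA a))
  linarith

lemma aux_sum {𝒳 𝒜 𝒴 : Type*} [Fintype 𝒳] [Fintype 𝒜] [Fintype 𝒴] [DecidableEq 𝒴]
    (W : 𝒳 → 𝒜 → 𝒴 → ℝ) (hW : ∀ x a, ∑ y, W x a y = 1)
    {n : ℕ} (pX : (Fin n → 𝒳) → ℝ) (pA : (Fin n → 𝒜) → ℝ)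
    (hpX : ∑ x, pX x = 1) (hpA : ∑ a, pA a = 1) :
    ∑ y, outDist W pX pA y = 1 := by
  unfold outDist
  rw [Finset.sum_comm]
  have : ∀ x : Fin n → 𝒳, ∑ y : Fin n → 𝒴, ∑ a : Fin n → 𝒜,
      pX x * pA a * ∏ j, W (x j) (a j) (y j) = pX x := by
    intro x
    rw [Finset.sum_comm]
    have h : ∀ a : Fin n → 𝒜, ∑ y : Fin n → 𝒴, pX x * pA a * ∏ j, W (x j) (a j) (y j)
        = pX x * pA a := by
      intro a
      rw [← Finset.mul_sum, ← Fintype.prod_sum (fun j y => W (x j) (a j) y)]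
      simp [hW]
    simp_rw [h]
    rw [← Finset.mul_sum, hpA, mul_one]
  simp_rw [this]
  exact hpX

lemma aux_pos {𝒳 𝒜 𝒴 : Type*} [Fintype 𝒳] [Fintype 𝒜] [Fintype 𝒴] [DecidableEq 𝒴]
    (W : 𝒳 → 𝒜 → 𝒴 → ℝ) (hW : ∀ x a, (∀ y, 0 < W x a y) ∧ ∑ y, W x a y = 1) (c : ℝ)
    (hc : ∀ x a y y', Real.log (W x a y / W x a y') ≤ c)
    {n : ℕ} (pX : (Fin n → 𝒳) → ℝ) (pA : (Fin n → 𝒜) → ℝ)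
    (hpX : IsDist pX) (hpA : IsDist pA) (y : Fin n → 𝒴) :
    0 < outDist W pX pA y := by
  by_contra hneg
  push Not at hneg
  have hs := aux_sum W (fun x a => (hW x a).2) pX pA hpX.2 hpA.2
  have : ∑ y, outDist W pX pA y ≤ 0 := by
    refine Finset.sum_nonpos fun z _ => ?_
    refine (aux_lip W (fun x a => (hW x a).1) c hc pX pA hpX.1 hpA.1 z y).trans ?_
    exact mul_nonpos_of_nonneg_of_nonpos (Real.exp_pos _).le hneg
  linarith

/-- Let `W` be a strictly positive stochastic matrix from `𝒳×𝒜` to `𝒴`, let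
`X, A, Ã` be independent with distributions `pX, pA, pÃ`, and let `Y, Ỹ` be the outputs of the
blocklength-`n` memoryless channel `∏ⱼ W(yⱼ|xⱼ,aⱼ)` on inputs `(X,A)` and `(X,Ã)`. Then
`|H(Y) − H(Ỹ)| ≤ c n d̄(P_Y, P_Ỹ)` with `c = max_{x,a,y,y'} log (W(y|x,a)/W(y'|x,a))`. -/
theorem stmt14 {𝒳 𝒜 𝒴 : Type*} [Fintype 𝒳] [Fintype 𝒜] [Fintype 𝒴]
    [Nonempty 𝒳] [Nonempty 𝒜] [Nonempty 𝒴] [DecidableEq 𝒴]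
    (W : 𝒳 → 𝒜 → 𝒴 → ℝ) (hW : ∀ x a, (∀ y, 0 < W x a y) ∧ ∑ y, W x a y = 1)
    {n : ℕ} (hn : 1 ≤ n)
    (pX : (Fin n → 𝒳) → ℝ) (pA pA' : (Fin n → 𝒜) → ℝ)
    (hpX : IsDist pX) (hpA : IsDist pA) (hpA' : IsDist pA') :
    |Hent (outDist W pX pA) - Hent (outDist W pX pA')| ≤
      (⨆ x, ⨆ a, ⨆ y, ⨆ y', Real.log (W x a y / W x a y')) * n *
        dbar n (outDist W pX pA) (outDist W pX pA') := by
  set c := ⨆ x, ⨆ a, ⨆ y, ⨆ y', Real.log (W x a y / W x a y') with hcdef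
  have hc : ∀ x a y y', Real.log (W x a y / W x a y') ≤ c := by
    intro x a y y'
    refine le_trans ?_ (le_ciSup (Set.finite_range _).bddAbove x)
    refine le_trans ?_ (le_ciSup (Set.finite_range _).bddAbove a)
    refine le_trans ?_ (le_ciSup (Set.finite_range _).bddAbove y)
    exact le_ciSup (f := fun y' => Real.log (W x a y / W x a y'))
      (Set.finite_range _).bddAbove y'
  clear_value c
  have hc0 : 0 ≤ c := by
    obtain ⟨x⟩ := ‹Nonempty 𝒳›
    obtain ⟨a⟩ := ‹Nonempty 𝒜›
    obtain ⟨y⟩ := ‹Nonempty 𝒴›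
    have := hc x a y y
    rwa [div_self ((hW x a).1 y).ne', Real.log_one] at this
  have hlog : ∀ p : (Fin n → 𝒜) → ℝ, IsDist p → ∀ y y' : Fin n → 𝒴,
      Real.log (outDist W pX p y) - Real.log (outDist W pX p y') ≤ c * hammingDist y y' := by
    intro p hp y y'
    have h1 := aux_lip W (fun x a => (hW x a).1) c hc pX p hpX.1 hp.1 y y'
    have h2 := aux_pos W hW c hc pX p hpX hp y
    have h3 := aux_pos W hW c hc pX p hpX hp y'
    have h4 := Real.log_le_log h2 h1
    rw [Real.log_mul (Real.exp_pos _).ne' h3.ne', Real.log_exp] at h4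
    linarith
  have hlA := hlog pA hpA
  have hlA' := hlog pA' hpA'
  have hpos := aux_pos W hW c hc pX pA hpX hpA
  have hpos' := aux_pos W hW c hc pX pA' hpX hpA'
  have hs := aux_sum W (fun x a => (hW x a).2) pX pA hpX.2 hpA.2
  have hs' := aux_sum W (fun x a => (hW x a).2) pX pA' hpX.2 hpA'.2
  generalize outDist W pX pA = P at *
  generalize outDist W pX pA' = Q at *
  have hn0 : (0 : ℝ) < n := by exact_mod_cast hn
  have main : ∀ g : (Fin n → 𝒴) × (Fin n → 𝒴) → ℝ, (∀ z, 0 ≤ g z) →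
      (∀ x, ∑ y, g (x, y) = P x) → (∀ y, ∑ x, g (x, y) = Q y) →
      |Hent P - Hent Q| ≤ c * ∑ z : (Fin n → 𝒴) × (Fin n → 𝒴),
        g z * (hammingDist z.1 z.2 : ℝ) := by
    intro g hg h1 h2
    rw [Fintype.sum_prod_type]
    have a1 := aux_one_side (fun y y' => (hammingDist y y' : ℝ)) c P Q hpos hpos' hs hs' hlA
      (fun x y => g (x, y)) (fun _ _ => hg _) h1 h2
    have a2 := aux_one_side (fun y y' => (hammingDist y y' : ℝ)) c Q P hpos' hpos hs' hs hlA'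
      (fun x y => g (y, x)) (fun _ _ => hg _) h2 h1
    rw [Finset.sum_comm] at a2
    simp_rw [fun y x : Fin n → 𝒴 => hammingDist_comm y x] at a2
    rw [abs_le]
    constructor
    · linarith
    · simpa [hammingDist_comm] using a2
  rcases hc0.eq_or_lt with h0 | hcpos
  · subst h0
    have := main (fun z => P z.1 * Q z.2) (fun z => mul_nonneg (hpos _).le (hpos' _).le)
      (fun x => by simp only []; rw [← Finset.mul_sum, hs', mul_one])
      (fun x => by simp only []; rw [← Finset.sum_mul, hs, one_mul])
    simpa using this
  · rw [mul_comm, ← div_le_iff₀ (mul_pos hcpos hn0)]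
    unfold dbar
    apply le_csInf
    · exact ⟨_, fun z => P z.1 * Q z.2, fun z => mul_nonneg (hpos _).le (hpos' _).le,
        fun x => by simp only []; rw [← Finset.mul_sum, hs', mul_one],
        fun x => by simp only []; rw [← Finset.sum_mul, hs, one_mul], rfl⟩
    · rintro r ⟨g, hg, h1, h2, rfl⟩
      rw [div_le_iff₀ (mul_pos hcpos hn0)]
      refine (main g hg h1 h2).trans (le_of_eq ?_)
      field_simp
end
end
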